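/- arXiv:2403.10661 — 3 statements merged into one kernel-verified Lean document; each statement's English description precedes it below -/
import Mathlib

section
/- Let C ⊆ A^n be a smooth irreducible algebraic curve which is not a line. Then dim(Tan(C)) = 2. -/
open MvPolynomial

/-- A subset of affine space is an algebraic set if it is the zero locus of an
ideal of polynomials. -/
def IsAlgebraicSet {K : Type} [Field K] {n : ℕ} (W : Set (Fin n → K)) : Prop :=
  ∃ I : Ideal (MvPolynomial (Fin n) K), W = zeroLocus K I

/-- An irreducible affine variety: an algebraic set whose vanishing ideal is prime. -/
def IsIrreducibleVariety {K : Type} [Field K] {n : ℕ} (W : Set (Fin n → K)) : Prop :=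
  IsAlgebraicSet W ∧ (vanishingIdeal K W).IsPrime

/-- The dimension of an affine algebraic set: the Krull dimension of its coordinate ring. -/
noncomputable def varDim {K : Type} [Field K] {n : ℕ} (W : Set (Fin n → K)) : ℕ :=
  ENat.toNat ((ringKrullDim (MvPolynomial (Fin n) K ⧸ vanishingIdeal K W)).unbotD 0)

/-- The (Zariski) tangent space of `W` at `p`:
all `y` with `∇f(p)·y = 0` for every `f ∈ I(W)`. -/
def tangentSpaceAt {K : Type} [Field K] {n : ℕ} (W : Set (Fin n → K)) (p : Fin n → K) :
    Set (Fin n → K) :=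
  {y | ∀ f ∈ vanishingIdeal K W, ∑ i, eval p (pderiv i f) * y i = 0}

/-- The dimension of the tangent space at a point. -/
noncomputable def tangentDimAt {K : Type} [Field K] {n : ℕ} (W : Set (Fin n → K))
    (p : Fin n → K) : ℕ :=
  Module.finrank K (Submodule.span K (tangentSpaceAt W p))

/-- A point of an (irreducible) variety is a smooth point when the tangent space has
the dimension of the variety. -/
def IsSmoothAt {K : Type} [Field K] {n : ℕ} (W : Set (Fin n → K)) (p : Fin n → K) : Prop :=
  tangentDimAt W p = varDim W

/-- A variety is smooth if it is smooth at each of its points. -/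
def IsSmoothVariety {K : Type} [Field K] {n : ℕ} (W : Set (Fin n → K)) : Prop :=
  ∀ p ∈ W, IsSmoothAt W p

/-- Projection `A^{2n} → A^n` to the first `n` coordinates. -/
def fstProj {K : Type} {n : ℕ} (z : Fin (n + n) → K) : Fin n → K :=
  fun i => z (Fin.castAdd n i)

/-- Projection `A^{2n} → A^n` to the last `n` coordinates. -/
def sndProj {K : Type} {n : ℕ} (z : Fin (n + n) → K) : Fin n → K :=
  fun i => z (Fin.natAdd n i)

/-- The tangent bundle `TW ⊆ A^{2n}`: pairs `(x, y)` with `x ∈ W` and `y ∈ T_x W`. -/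
def tangentBundle {K : Type} [Field K] {n : ℕ} (W : Set (Fin n → K)) :
    Set (Fin (n + n) → K) :=
  {z | fstProj z ∈ W ∧ sndProj z ∈ tangentSpaceAt W (fstProj z)}

/-- Zariski closure of a subset of affine space. -/
def zclosure {K : Type} [Field K] {n : ℕ} (W : Set (Fin n → K)) : Set (Fin n → K) :=
  zeroLocus K (vanishingIdeal K W)

/-- The tangential variety `Tan(W)`: the Zariski closure of `π₂(TW)`. -/
def tangentialVariety {K : Type} [Field K] {n : ℕ} (W : Set (Fin n → K)) :
    Set (Fin n → K) :=
  zclosure (sndProj '' tangentBundle W)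

/-- The geometric degree of an (irreducible) affine algebraic set: the maximal finite
number of points in an intersection with an affine-linear subspace of complementary
dimension. -/
noncomputable def geomDegree {K : Type} [Field K] {n : ℕ} (W : Set (Fin n → K)) : ℕ :=
  sSup {m | ∃ L : AffineSubspace K (Fin n → K),
    Module.finrank K L.direction = n - varDim W ∧
    (W ∩ (L : Set (Fin n → K))).Finite ∧ (W ∩ (L : Set (Fin n → K))).ncard = m}

/-- A linear variety: an affine-linear subspace of affine space. -/
def IsLinearVariety {K : Type} [Field K] {n : ℕ} (W : Set (Fin n → K)) : Prop :=
  ∃ L : AffineSubspace K (Fin n → K), W = (L : Set (Fin n → K))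

/-- A line: an affine-linear subspace of dimension 1. -/
def IsLine {K : Type} [Field K] {n : ℕ} (W : Set (Fin n → K)) : Prop :=
  ∃ L : AffineSubspace K (Fin n → K), W = (L : Set (Fin n → K)) ∧
    Module.finrank K L.direction = 1

open Classical in
/-- `ω(C)`: the number of points in the fiber of `π₂ : TC → Tan(C)` over a generic
point of `Tan(C)`; it is `0` when `C` is a line. -/
noncomputable def omegaCurve {K : Type} [Field K] {n : ℕ} (C : Set (Fin n → K)) : ℕ :=
  if IsLine C then 0
  else sInf {m | ∃ Z : Set (Fin n → K), IsAlgebraicSet Z ∧ ¬ tangentialVariety C ⊆ Z ∧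
    ∀ v ∈ tangentialVariety C \ Z,
      {z ∈ tangentBundle C | sndProj z = v}.ncard = m}

/-- A smooth irreducible algebraic curve. -/
def IsSmoothCurve {K : Type} [Field K] {n : ℕ} (C : Set (Fin n → K)) : Prop :=
  IsIrreducibleVariety C ∧ varDim C = 1 ∧ IsSmoothVariety C

theorem aux_krull_integral {A B : Type} [CommRing A] [CommRing B] [Algebra A B]
    [Algebra.IsIntegral A B] (hinj : Function.Injective (algebraMap A B)) :
    ringKrullDim A = ringKrullDim B := by
  apply le_antisymm
  · have key : ∀ p : LTSeries (PrimeSpectrum A), ∃ q : LTSeries (PrimeSpectrum B),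
        q.length = p.length ∧ PrimeSpectrum.comap (algebraMap A B) q.last = p.last := by
      intro p
      induction p using RelSeries.inductionOn' with
      | singleton x =>
        obtain ⟨Q, hQ, hQ1, hQ2⟩ := Ideal.exists_ideal_over_prime_of_isIntegral (S := B)
          x.asIdeal ⊥ (by
            rw [← RingHom.ker_eq_comap_bot, (RingHom.injective_iff_ker_eq_bot _).1 hinj]
            exact bot_le)
        exact ⟨RelSeries.singleton _ ⟨Q, hQ1⟩, rfl, PrimeSpectrum.ext hQ2⟩
      | snoc p x hx ih =>
        obtain ⟨q, hq1, hq2⟩ := ih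
        have hlt : p.last < x := hx
        obtain ⟨Q, hQ, hQ1, hQ2⟩ := Ideal.exists_ideal_over_prime_of_isIntegral (S := B)
          x.asIdeal q.last.asIdeal (by
            have : (PrimeSpectrum.comap (algebraMap A B) q.last).asIdeal ≤ x.asIdeal := by
              rw [hq2]; exact hlt.le
            exact this)
        have hlt2 : q.last < ⟨Q, hQ1⟩ := by
          refine lt_of_le_of_ne hQ ?_
          intro h
          have : PrimeSpectrum.comap (algebraMap A B) q.last = x := by
            rw [h]; exact PrimeSpectrum.ext hQ2
          rw [hq2] at this
          exact hlt.ne this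
        refine ⟨q.snoc ⟨Q, hQ1⟩ hlt2, by simp [hq1], ?_⟩
        simp only [RelSeries.last_snoc]
        exact PrimeSpectrum.ext hQ2
    refine iSup_le fun p => ?_
    obtain ⟨q, hq, -⟩ := key p
    rw [← hq]
    exact le_iSup (fun q : LTSeries (PrimeSpectrum B) => ((q.length : ℕ∞) : WithBot ℕ∞)) q
  · refine Order.krullDim_le_of_strictMono (PrimeSpectrum.comap (algebraMap A B)) ?_
    intro I J h
    exact Ideal.IsIntegral.comap_lt_comap (R := A) (A := B) h

theorem aux_krull_trdeg (K A : Type) [Field K] [CommRing A] [IsDomain A] [Algebra K A]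
    [Algebra.FiniteType K A] :
    ∃ s : ℕ, ringKrullDim A = s ∧ Algebra.trdeg K A = s := by
  obtain ⟨s, g, hg, hi⟩ := exists_integral_inj_algHom_of_fg K A
  refine ⟨s, ?_, ?_⟩
  · let _ := g.toRingHom.toAlgebra
    have : Algebra.IsIntegral (MvPolynomial (Fin s) K) A := ⟨hi⟩
    rw [← aux_krull_integral (A := MvPolynomial (Fin s) K) (B := A) hg]
    rw [MvPolynomial.ringKrullDim_of_isNoetherianRing]
    simp
  · let _ := g.toRingHom.toAlgebra
    have : Algebra.IsIntegral (MvPolynomial (Fin s) K) A := ⟨hi⟩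
    have : IsScalarTower K (MvPolynomial (Fin s) K) A :=
      IsScalarTower.of_algebraMap_eq fun x => (g.commutes x).symm
    have : FaithfulSMul (MvPolynomial (Fin s) K) A :=
      (faithfulSMul_iff_algebraMap_injective _ _).2 hg
    rw [← trdeg_add_eq K (MvPolynomial (Fin s) K) (A := A), MvPolynomial.trdeg_of_isDomain,
      trdeg_eq_zero]
    simp

theorem aux_card {a b : Cardinal.{0}} (h : a + b = 1) (ha : a ≠ 0) : b = 0 := by
  have h1 : a < Cardinal.aleph0 := lt_of_le_of_lt (h ▸ self_le_add_right a b) Cardinal.one_lt_aleph0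
  have h2 : b < Cardinal.aleph0 := lt_of_le_of_lt (h ▸ self_le_add_left b a) Cardinal.one_lt_aleph0
  lift a to ℕ using h1
  lift b to ℕ using h2
  have h' : a + b = 1 := by exact_mod_cast h
  have ha' : a ≠ 0 := by exact_mod_cast ha
  have : b = 0 := by omega
  simp [this]

/-- In a field of transcendence degree one, the field is algebraic over any intermediate
field containing a transcendental element. -/
theorem aux_alg_over {K F : Type} [Field K] [Field F] [Algebra K F]
    (h1 : Algebra.trdeg K F = 1) (E : IntermediateField K F) (b : F) (hb : b ∈ E)
    (hbt : Transcendental K b) : Algebra.IsAlgebraic E F := by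
  rw [← trdeg_eq_zero_iff]
  refine aux_card (a := Algebra.trdeg K E) ?_ ?_
  · rw [← h1]; exact trdeg_add_eq K E (A := F)
  · rw [trdeg_ne_zero_iff]
    refine ⟨⟨⟨b, hb⟩, ?_⟩⟩
    intro h
    exact hbt (h.algebraMap (A := F))

theorem aux_const {K F : Type} [Field K] [IsAlgClosed K] [Field F] [Algebra K F] {b : F}
    (hb : IsAlgebraic K b) : ∃ c : K, algebraMap K F c = b :=
  minpoly.mem_range_of_degree_eq_one K b
    (IsAlgClosed.degree_eq_one_of_irreducible K (minpoly.irreducible hb.isIntegral))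

theorem aux_derivation {K F : Type} [Field K] [CharZero K] [IsAlgClosed K] [Field F] [Algebra K F]
    [Algebra.EssFiniteType K F] (h1 : Algebra.trdeg K F = 1) :
    ∃ D : Derivation K F F, (∃ z, D z ≠ 0) ∧ ∀ b, D b = 0 → ∃ c : K, algebraMap K F c = b := by
  have hne : ¬ Subsingleton (Ω[F⁄K]) := by
    intro h
    have : Algebra.FormallyUnramified K F := ⟨h⟩
    have := Algebra.FormallyUnramified.isSeparable K F
    have h0 : Algebra.trdeg K F = 0 := trdeg_eq_zero
    rw [h1] at h0
    exact one_ne_zero h0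
  rw [not_subsingleton_iff_nontrivial] at hne
  obtain ⟨ω, hω⟩ := exists_ne (0 : Ω[F⁄K])
  obtain ⟨l, hl⟩ : ∃ l : Ω[F⁄K] →ₗ[F] F, l ω ≠ 0 := by
    by_contra! hcon
    exact hω ((Module.forall_dual_apply_eq_zero_iff F ω).1 hcon)
  let D : Derivation K F F := l.compDer (KaehlerDifferential.D K F)
  have hD : ∃ z, D z ≠ 0 := by
    by_contra! hcon
    have : l = 0 := Derivation.liftKaehlerDifferential_unique _ _ (by
      ext z
      simpa [D] using hcon z)
    exact hl (by simp [this])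
  refine ⟨D, hD, ?_⟩
  intro b hb
  by_cases hbt : IsAlgebraic K b
  · exact aux_const hbt
  exfalso
  let E : IntermediateField K F :=
    { carrier := {z | D z = 0}
      mul_mem' := by
        intro x y hx hy
        simp only [Set.mem_ofPred_eq] at *
        simp [Derivation.leibniz, hx, hy]
      add_mem' := by
        intro x y hx hy
        simp only [Set.mem_ofPred_eq] at *
        simp [hx, hy]
      algebraMap_mem' := fun r => D.map_algebraMap r
      inv_mem' := by
        intro x hx
        simp only [Set.mem_ofPred_eq] at *
        simp [Derivation.leibniz_inv, hx] }
  have halg := aux_alg_over h1 E b hb hbt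
  have := Algebra.FormallyUnramified.of_isSeparable E F
  let D' : Derivation E F F :=
    { toFun := D
      map_add' := D.map_add
      map_smul' := by
        intro m x
        have hm : D (m : F) = 0 := m.2
        simp [Algebra.smul_def, Derivation.leibniz, hm]
      map_one_eq_zero' := D.map_one_eq_zero
      leibniz' := D.leibniz }
  obtain ⟨z, hz⟩ := hD
  apply hz
  have h0 : D' z = 0 := by
    rw [← D'.liftKaehlerDifferential_comp_D z, Subsingleton.elim (KaehlerDifferential.D E F z) 0,
      map_zero]
  exact h0

theorem aux_trdeg_two {K F : Type} [Field K] [Field F] [Algebra K F]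
    (h1 : Algebra.trdeg K F = 1) {n : ℕ} (d : Fin n → F) (i j : Fin n) (hj : d j ≠ 0)
    (ht : Transcendental K (d i / d j)) :
    Algebra.trdeg K (aeval (R := K) (fun k => Polynomial.C (d k) * Polynomial.X :
      Fin n → Polynomial F)).range = 2 := by
  set A := (aeval (R := K) (fun k => Polynomial.C (d k) * Polynomial.X :
      Fin n → Polynomial F)).range with hA
  have hmem : ∀ k, Polynomial.C (d k) * Polynomial.X ∈ A := fun k => ⟨X k, by simp⟩
  have hX : ∀ k, IsAlgebraic A (Polynomial.C (d k) * Polynomial.X : Polynomial F) := fun k =>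
    isAlgebraic_algebraMap (A := Polynomial F) (⟨_, hmem k⟩ : A)
  set u := d i / d j with hu
  have hualg : IsAlgebraic A (Polynomial.C u) := by
    refine ⟨Polynomial.C ⟨_, hmem j⟩ * Polynomial.X - Polynomial.C ⟨_, hmem i⟩, ?_, ?_⟩
    · intro h
      have := congrArg (fun p => Polynomial.coeff p 1) h
      simp [Polynomial.coeff_C] at this
      have h3 : Polynomial.C (d j) * Polynomial.X = (0 : Polynomial F) :=
        congrArg (fun q : A => (q : Polynomial F)) this
      simp at h3
      exact hj h3
    · simp only [map_sub, map_mul, Polynomial.aeval_C, Polynomial.aeval_X]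
      change Polynomial.C (d j) * Polynomial.X * Polynomial.C u -
        Polynomial.C (d i) * Polynomial.X = 0
      rw [mul_right_comm, ← Polynomial.C_mul, hu, mul_div_cancel₀ _ hj, sub_self]
  let A' := Subalgebra.algebraicClosure A (Polynomial F)
  have hFalg : ∀ z : F, IsAlgebraic A (Polynomial.C z) := by
    intro z
    have halgI : AlgebraicIndependent K (fun _ : Unit => u) :=
      algebraicIndependent_unique_type_iff.2 ht
    have hb := halgI.isTranscendenceBasis_of_trdeg_le_of_finite (by simp [h1])
    have hz := hb.isAlgebraic.1 z
    have hsub : ∀ w ∈ Algebra.adjoin K (Set.range fun _ : Unit => u), Polynomial.C w ∈ A' := by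
      intro w hw
      induction hw using Algebra.adjoin_induction with
      | mem x hx => obtain ⟨_, rfl⟩ := hx; exact hualg
      | algebraMap r =>
        have : Polynomial.C (algebraMap K F r) = algebraMap A (Polynomial F) (algebraMap K A r) := rfl
        rw [this]; exact A'.algebraMap_mem _
      | add x y _ _ hx hy => rw [Polynomial.C_add]; exact A'.add_mem hx hy
      | mul x y _ _ hx hy => rw [Polynomial.C_mul]; exact A'.mul_mem hx hy
    let f : Algebra.adjoin K (Set.range fun _ : Unit => u) →+* A' :=
      (Polynomial.C.comp (Algebra.adjoin K (Set.range fun _ : Unit => u)).val.toRingHom).codRestrict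
        A' (fun w => hsub w.1 w.2)
    have h2 : IsAlgebraic A' (Polynomial.C z) :=
      hz.ringHom_of_comp_eq f Polynomial.C (by
        intro x y hxy
        have := congrArg (fun q : A' => (q : Polynomial F)) hxy
        exact Subtype.ext (Polynomial.C_injective this)) rfl
    exact h2.restrictScalars A
  have hXalg : IsAlgebraic A (Polynomial.X : Polynomial F) := by
    have := (hFalg (d j)⁻¹).mul (hX j)
    rwa [← mul_assoc, ← Polynomial.C_mul, inv_mul_cancel₀ hj, Polynomial.C_1, one_mul] at this
  have hall : Algebra.IsAlgebraic A (Polynomial F) := by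
    refine ⟨fun p => ?_⟩
    induction p using Polynomial.induction_on' with
    | add p q hp hq => exact hp.add hq
    | monomial m c =>
      rw [← Polynomial.C_mul_X_pow_eq_monomial]
      exact (hFalg c).mul (hXalg.pow m)
  have e1 := trdeg_add_eq K A (A := Polynomial F)
  rw [trdeg_eq_zero (R := A) (A := Polynomial F), add_zero] at e1
  rw [e1, ← trdeg_add_eq K F (A := Polynomial F), h1, Polynomial.trdeg_of_isDomain]
  norm_num

theorem aux_chain {K F : Type} [Field K] [Field F] [Algebra K F] {n : ℕ}
    (D : Derivation K F F) (a : Fin n → F) (f : MvPolynomial (Fin n) K) :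
    D (aeval a f) = ∑ i, aeval a (pderiv i f) * D (a i) := by
  induction f using MvPolynomial.induction_on with
  | C c => simp
  | add p q hp hq => simp [hp, hq, add_mul, Finset.sum_add_distrib]
  | mul_X p j hp =>
    simp only [map_mul, Derivation.leibniz, aeval_X, hp, smul_eq_mul, pderiv_X, map_add, add_mul,
      Finset.sum_add_distrib, Finset.mul_sum]
    congr 1
    · rw [Finset.sum_eq_single j]
      · simp
      · intro b _ hb
        simp [Pi.single_apply, hb.symm]
      · simp
    · refine Finset.sum_congr rfl fun i _ => by ring

theorem aux_lin {L : Type} [Field L] {m : ℕ} (N : Matrix (Fin (m + 1)) (Fin (m + 1)) L)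
    (hdet : N.det ≠ 0) (y : Fin (m + 1) → L) (hy : ∀ r : Fin m, (N.mulVec y) r.succ = 0) :
    ∃ c : L, ∀ j, y j = c * N.adjugate j 0 := by
  refine ⟨N.mulVec y 0 / N.det, fun j => ?_⟩
  have h1 : N.adjugate.mulVec (N.mulVec y) = N.det • y := by
    rw [Matrix.mulVec_mulVec, Matrix.adjugate_mul, Matrix.smul_mulVec, Matrix.one_mulVec]
  have h2 := congrFun h1 j
  rw [Matrix.mulVec, dotProduct, Fin.sum_univ_succ] at h2
  simp only [hy, mul_zero, Finset.sum_const_zero, add_zero, Pi.smul_apply, smul_eq_mul] at h2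
  field_simp
  linear_combination -h2

/-- The gradient at `p` as a linear functional. -/
noncomputable def gradAt {K : Type} [Field K] {n : ℕ} (p : Fin n → K) :
    MvPolynomial (Fin n) K →ₗ[K] Module.Dual K (Fin n → K) where
  toFun f := ∑ i, eval p (pderiv i f) • LinearMap.proj i
  map_add' f g := by simp [add_smul, Finset.sum_add_distrib]
  map_smul' c f := by simp [Finset.smul_sum, mul_smul, smul_eval]

theorem gradAt_apply {K : Type} [Field K] {n : ℕ} (p y : Fin n → K)
    (f : MvPolynomial (Fin n) K) : gradAt p f y = ∑ i, eval p (pderiv i f) * y i := by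
  simp [gradAt]

theorem aux_basis {K V : Type} [Field K] [AddCommGroup V] [Module K V] [FiniteDimensional K V]
    (W : Submodule K V) (m : ℕ) (hm : Module.finrank K W = m) (hV : Module.finrank K V = m + 1) :
    ∃ u : Fin (m + 1) → V, LinearIndependent K u ∧ ∀ k : Fin m, u k.succ ∈ W := by
  let b := Module.finBasisOfFinrankEq K W hm
  have hW : W ≠ ⊤ := by
    intro h
    rw [h, finrank_top, hV] at hm
    omega
  obtain ⟨u, hu⟩ : ∃ u, u ∉ W := by
    by_contra! h
    exact hW (eq_top_iff.2 fun x _ => h x)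
  refine ⟨Fin.cons u (fun k => (b k : V)), ?_, fun k => by simp⟩
  rw [linearIndependent_finCons]
  refine ⟨b.linearIndependent.map' W.subtype W.ker_subtype, ?_⟩
  intro h
  apply hu
  refine Submodule.span_le.2 ?_ h
  rintro _ ⟨k, rfl⟩
  exact (b k).2

theorem aux_frame {K : Type} [Field K] {n : ℕ} (C : Set (Fin n → K)) (p : Fin n → K) (hp : p ∈ C)
    (hdim : tangentDimAt C p = 1) :
    ∃ v : Fin n → MvPolynomial (Fin n) K,
      (∀ y ∈ tangentSpaceAt C p, ∃ c : K, ∀ j, y j = c * eval p (v j)) ∧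
      ∀ (F : Type) [Field F] [Algebra K F] (a d : Fin n → F),
        (∀ f, aeval a f = 0 → f ∈ vanishingIdeal K C) →
        (∀ f ∈ vanishingIdeal K C, ∑ i, aeval a (pderiv i f) * d i = 0) →
        ∃ c : F, ∀ j, d j = c * aeval a (v j) := by
  let W : Submodule K (Module.Dual K (Fin n → K)) :=
    ((vanishingIdeal K C).restrictScalars K).map (gradAt p)
  have hT : tangentSpaceAt C p = (W.dualCoannihilator : Set (Fin n → K)) := by
    ext y
    simp only [tangentSpaceAt, SetLike.mem_coe, Submodule.mem_dualCoannihilator, W,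
      Submodule.mem_map, Submodule.restrictScalars_mem]
    constructor
    · rintro h _ ⟨f, hf, rfl⟩
      rw [gradAt_apply]; exact h f hf
    · intro h f hf
      rw [← gradAt_apply]; exact h _ ⟨f, hf, rfl⟩
  have hfr := Subspace.finrank_add_finrank_dualCoannihilator_eq W
  rw [tangentDimAt, hT, Submodule.span_eq] at hdim
  rw [hdim, Module.finrank_fin_fun] at hfr
  obtain ⟨m, hm⟩ : ∃ m, Module.finrank K W = m := ⟨_, rfl⟩
  rw [hm] at hfr
  subst hfr
  obtain ⟨u, hli, huW⟩ := aux_basis W m hm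
    (by rw [Subspace.dual_finrank_eq, Module.finrank_fin_fun])
  have hf : ∀ k : Fin m, ∃ f ∈ vanishingIdeal K C, gradAt p f = u k.succ := by
    intro k
    obtain ⟨f, hf, h⟩ := huW k
    exact ⟨f, hf, h⟩
  choose f hfI hfb using hf
  let M : Matrix (Fin (m + 1)) (Fin (m + 1)) (MvPolynomial (Fin (m + 1)) K) :=
    Fin.cons (fun j => MvPolynomial.C (u 0 (Pi.single j 1))) (fun k j => pderiv j (f k))
  have hMp : (M.map (eval p)).det ≠ 0 := by
    have h1 := hli.map' (((Pi.basisFun K (Fin (m + 1))).constr K).symm.toLinearMap)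
      (LinearEquiv.ker _)
    have h2 : LinearIndependent K (M.map (eval p)).row := by
      have e : (M.map (eval p)).row =
          (((Pi.basisFun K (Fin (m + 1))).constr K).symm.toLinearMap) ∘ u := by
        funext r j
        have e2 : ((((Pi.basisFun K (Fin (m + 1))).constr K).symm.toLinearMap) ∘ u) r j =
          u r (Pi.single j 1) := by
          rw [← Pi.basisFun_apply]; rfl
        rw [e2]
        refine Fin.cases ?_ (fun k => ?_) r
        · change eval p (MvPolynomial.C _) = _
          simp
        · rw [← hfb, gradAt_apply]
          change eval p (pderiv j (f k)) = _
          simp [Pi.single_apply]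
      rw [e]; exact h1
    rw [Matrix.linearIndependent_rows_iff_isUnit, Matrix.isUnit_iff_isUnit_det] at h2
    exact h2.ne_zero
  refine ⟨fun j => M.adjugate j 0, ?_, ?_⟩
  · intro y hy
    obtain ⟨c, hc⟩ := aux_lin (M.map (eval p)) hMp y (by
      intro r
      rw [hT] at hy
      have h3 := (Submodule.mem_dualCoannihilator y).1 hy _ (huW r)
      rw [← hfb, gradAt_apply] at h3
      exact h3)
    refine ⟨c, fun j => ?_⟩
    rw [hc j]
    congr 1
    have := (eval p).map_adjugate M
    exact (congrFun (congrFun this j) 0).symm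
  · intro F _ _ a d hker hd
    let g : MvPolynomial (Fin (m + 1)) K →+* F := (aeval a : MvPolynomial (Fin (m + 1)) K →ₐ[K] F)
    have hdet : (M.map g).det ≠ 0 := by
      intro h
      have h4 : g M.det = 0 := by rw [RingHom.map_det]; exact h
      have h5 := hker _ h4 p hp
      apply hMp
      have h6 : eval p M.det = 0 := by rw [← h5]; simp [aeval_eq_eval]
      rw [RingHom.map_det] at h6
      exact h6
    obtain ⟨c, hc⟩ := aux_lin (M.map g) hdet d (fun r => hd _ (hfI r))
    refine ⟨c, fun j => ?_⟩
    rw [hc j]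
    congr 1
    have := g.map_adjugate M
    exact (congrFun (congrFun this j) 0).symm

theorem aux_fst {K : Type} {n : ℕ} (x y : Fin n → K) : fstProj (Fin.append x y) = x :=
  funext fun i => Fin.append_left x y i

theorem aux_snd {K : Type} {n : ℕ} (x y : Fin n → K) : sndProj (Fin.append x y) = y :=
  funext fun i => Fin.append_right x y i

theorem aux_clear {K F : Type} [Field K] [Field F] [Algebra K F] {n : ℕ} (a : Fin n → F)
    (hgen : ∀ z : F, ∃ p q : MvPolynomial (Fin n) K, aeval a q ≠ 0 ∧ z * aeval a q = aeval a p)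
    (d : Fin n → F) :
    ∃ (Q : F) (w : Fin n → MvPolynomial (Fin n) K), Q ≠ 0 ∧ ∀ i, d i * Q = aeval a (w i) := by
  choose num den hden hnum using fun i => hgen (d i)
  refine ⟨∏ i, aeval a (den i), fun i => num i * ∏ k ∈ Finset.univ.erase i, den k,
    Finset.prod_ne_zero_iff.2 fun i _ => hden i, fun i => ?_⟩
  rw [← Finset.mul_prod_erase _ _ (Finset.mem_univ i), ← mul_assoc, hnum, map_mul, map_prod]

theorem aux_ideal {K F : Type} [Field K] [Infinite K] [Field F] [Algebra K F] {n : ℕ}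
    (C : Set (Fin n → K)) (hsm : ∀ p ∈ C, tangentDimAt C p = 1) (a : Fin n → F)
    (hker : ∀ f, aeval a f = 0 ↔ f ∈ vanishingIdeal K C)
    (hgen : ∀ z : F, ∃ p q : MvPolynomial (Fin n) K, aeval a q ≠ 0 ∧ z * aeval a q = aeval a p)
    (D : Derivation K F F) (j : Fin n) (hj : D (a j) ≠ 0) (f : MvPolynomial (Fin n) K) :
    f ∈ vanishingIdeal K (sndProj '' tangentBundle C) ↔
      aeval (R := K) (fun k => Polynomial.C (D (a k)) * Polynomial.X : Fin n → Polynomial F) f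
        = 0 := by
  have hD : ∀ g ∈ vanishingIdeal K C, ∑ i, aeval a (pderiv i g) * D (a i) = 0 := by
    intro g hg
    rw [← aux_chain, (hker g).2 hg, map_zero]
  constructor
  · intro hf
    obtain ⟨Q, w, hQ, hw⟩ := aux_clear a hgen (fun i => D (a i))
    have hroot : ∀ c : K, aeval (R := K) (fun i => algebraMap K F c * aeval a (w i)) f = 0 := by
      intro c
      have hmem : aeval (R := K) (fun i => MvPolynomial.C c * w i) f ∈ vanishingIdeal K C := by
        intro p hp
        rw [comp_aeval_apply]
        apply hf
        refine ⟨Fin.append p (fun i => aeval p (MvPolynomial.C c * w i)), ⟨?_, ?_⟩, ?_⟩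
        · rw [aux_fst]; exact hp
        · rw [aux_fst, aux_snd]
          intro g hg
          have h1 : ∑ i, pderiv i g * w i ∈ vanishingIdeal K C := by
            rw [← hker, map_sum]
            have := congrArg (fun z => z * Q) (hD g hg)
            simp only [Finset.sum_mul, zero_mul, mul_assoc, hw] at this
            simpa using this
          have h2 := h1 p hp
          simp only [map_sum, map_mul] at h2
          have h3 := congrArg (fun z => c * z) h2
          simp only [Finset.mul_sum, mul_zero] at h3
          rw [← h3]
          refine Finset.sum_congr rfl fun i _ => ?_
          simp [aeval_eq_eval]
          ring
        · exact aux_snd _ _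
      have h4 := (hker _).2 hmem
      rw [comp_aeval_apply] at h4
      simpa using h4
    have hG : aeval (R := K) (fun k => Polynomial.C (aeval a (w k)) * Polynomial.X :
        Fin n → Polynomial F) f = 0 := by
      refine Polynomial.eq_zero_of_infinite_isRoot _ ?_
      refine Set.Infinite.mono (s := Set.range (algebraMap K F)) ?_
        (Set.infinite_range_of_injective (algebraMap K F).injective)
      rintro _ ⟨c, rfl⟩
      change Polynomial.eval _ _ = 0
      have h5 := comp_aeval_apply (R := K) (fun k => Polynomial.C (aeval a (w k)) * Polynomial.X :
        Fin n → Polynomial F)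
        ((Polynomial.aeval (R := F) (algebraMap K F c)).restrictScalars K) f
      rw [← Polynomial.coe_aeval_eq_eval]
      refine Eq.trans h5 ?_
      rw [← hroot c]
      congr 2
      funext i
      simp only [AlgHom.coe_restrictScalars', map_mul, Polynomial.aeval_C, Polynomial.aeval_X,
        Algebra.algebraMap_self, RingHom.id_apply]
      exact mul_comm _ _
    have h6 := comp_aeval_apply (R := K) (fun k => Polynomial.C (aeval a (w k)) * Polynomial.X :
        Fin n → Polynomial F)
        ((Polynomial.aeval (R := F) (Polynomial.C Q⁻¹ * Polynomial.X)).restrictScalars K) f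
    rw [hG, map_zero] at h6
    rw [h6]
    congr 2
    funext i
    simp only [AlgHom.coe_restrictScalars', map_mul, Polynomial.aeval_C, Polynomial.aeval_X,
      Polynomial.algebraMap_eq, ← hw]
    rw [← mul_assoc, ← Polynomial.C_mul, ← Polynomial.C_mul, mul_assoc, mul_inv_cancel₀ hQ, mul_one]
  · rintro hf _ ⟨z, ⟨hz1, hz2⟩, rfl⟩
    generalize fstProj z = p at hz1 hz2
    generalize sndProj z = y at hz2
    obtain ⟨v, hv1, hv2⟩ := aux_frame C p hz1 (hsm p hz1)
    obtain ⟨c, hc⟩ := hv1 y hz2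
    obtain ⟨l, hl⟩ := hv2 F a (fun i => D (a i)) (fun f => (hker f).1) hD
    have hl0 : l ≠ 0 := by
      rintro rfl
      apply hj
      rw [hl j, zero_mul]
    have h7 := comp_aeval_apply (R := K) (fun k => Polynomial.C (D (a k)) * Polynomial.X :
        Fin n → Polynomial F)
        ((Polynomial.aeval (R := F) (algebraMap K F c / l)).restrictScalars K) f
    rw [hf, map_zero] at h7
    have h8 : aeval (R := K) (fun i => MvPolynomial.C c * v i) f ∈ vanishingIdeal K C := by
      rw [← hker, comp_aeval_apply, h7]
      congr 2
      funext i
      simp only [AlgHom.coe_restrictScalars', map_mul, Polynomial.aeval_C, Polynomial.aeval_X,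
        aeval_C, hl i, Algebra.algebraMap_self, RingHom.id_apply]
      field_simp
    have h9 := h8 p hz1
    rw [comp_aeval_apply] at h9
    rw [← h9]
    congr 2
    funext i
    rw [hc i]
    simp [aeval_eq_eval]

theorem aux_line {K F : Type} [Field K] [IsAlgClosed K] [Field F] [Algebra K F] {n : ℕ}
    (C : Set (Fin n → K)) (hC : IsAlgebraicSet C) (a : Fin n → F)
    (hker : ∀ f, aeval a f = 0 ↔ f ∈ vanishingIdeal K C)
    (D : Derivation K F F) (hconst : ∀ b, D b = 0 → ∃ c : K, algebraMap K F c = b)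
    (j : Fin n) (hj : D (a j) ≠ 0) (halg : ∀ i, IsAlgebraic K (D (a i) / D (a j))) :
    IsLine C := by
  choose c hc using fun i => aux_const (halg i)
  have h1 : ∀ i, ∃ e : K, algebraMap K F e = a i - algebraMap K F (c i) * a j := by
    intro i
    apply hconst
    rw [map_sub, Derivation.leibniz, D.map_algebraMap, hc i]
    simp only [smul_eq_mul, mul_zero, add_zero]
    rw [div_mul_cancel₀ _ hj, sub_self]
  choose e he using h1
  have hcj : c j = 1 := by
    apply (algebraMap K F).injective
    rw [hc j, div_self hj, map_one]
  have htr : Transcendental K (a j) := by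
    intro h
    obtain ⟨x, hx⟩ := aux_const h
    apply hj
    rw [← hx, D.map_algebraMap]
  have hc0 : c ≠ 0 := by
    intro h
    rw [h] at hcj
    simp at hcj
  obtain ⟨I, hI⟩ := hC
  refine ⟨AffineSubspace.mk' e (Submodule.span K {c}), ?_, ?_⟩
  · ext p
    rw [SetLike.mem_coe, AffineSubspace.mem_mk', Submodule.mem_span_singleton]
    constructor
    · intro hp
      refine ⟨p j, ?_⟩
      funext i
      have hmem : (X i - MvPolynomial.C (c i) * X j - MvPolynomial.C (e i) :
          MvPolynomial (Fin n) K) ∈ vanishingIdeal K C := by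
        rw [← hker]
        simp [he]
      have := hmem p hp
      simp at this
      simp only [Pi.smul_apply, smul_eq_mul, vsub_eq_sub, Pi.sub_apply]
      linear_combination -this
    · rintro ⟨s, hs⟩
      rw [hI]
      intro f hf
      have hfC : f ∈ vanishingIdeal K C := by
        intro x hx
        rw [hI] at hx
        exact hx f hf
      rw [← hker] at hfC
      let G : Polynomial K := aeval (R := K) (fun i => Polynomial.C (c i) * Polynomial.X +
        Polynomial.C (e i)) f
      have hG : Polynomial.aeval (a j) G = 0 := by
        simp only [G]
        rw [comp_aeval_apply, ← hfC]
        congr 2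
        funext i
        simp [he]
      have hG0 : G = 0 := by
        by_contra hne
        exact htr ⟨G, hne, hG⟩
      have h2 : Polynomial.aeval s G = 0 := by rw [hG0, map_zero]
      simp only [G] at h2
      rw [comp_aeval_apply] at h2
      rw [← h2]
      congr 2
      funext i
      have := congrFun hs i
      simp only [Pi.smul_apply, smul_eq_mul, vsub_eq_sub, Pi.sub_apply] at this
      simp
      linear_combination -this
  · rw [AffineSubspace.direction_mk', finrank_span_singleton hc0]

theorem aux_dim {K : Type} [Field K] {n : ℕ} (W : Set (Fin n → K))
    (hW : (vanishingIdeal K W).IsPrime) :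
    Algebra.trdeg K (MvPolynomial (Fin n) K ⧸ vanishingIdeal K W) = varDim W := by
  obtain ⟨s, h1, h2⟩ := aux_krull_trdeg K (MvPolynomial (Fin n) K ⧸ vanishingIdeal K W)
  rw [h2, varDim, h1]
  rfl

/-- The tangential variety of a smooth irreducible curve which is not a line
has dimension `2`. -/
theorem dim_tangentialVariety_of_curve {K : Type} [Field K] [IsAlgClosed K] [CharZero K]
    {n : ℕ} (C : Set (Fin n → K)) (hC : IsSmoothCurve C) (hl : ¬ IsLine C) :
    varDim (tangentialVariety C) = 2 := by
  obtain ⟨⟨hCalg, hprime⟩, hdim, hsm⟩ := hC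
  have hsm' : ∀ p ∈ C, tangentDimAt C p = 1 := fun p hp => (hsm p hp).trans hdim
  let R := MvPolynomial (Fin n) K ⧸ vanishingIdeal K C
  let F := FractionRing R
  have htr : Algebra.trdeg K R = 1 := by
    rw [aux_dim C hprime, hdim]; simp
  have htrF : Algebra.trdeg K F = 1 := by
    have h := trdeg_add_eq K R (A := F)
    have : Algebra.IsAlgebraic R F := IsLocalization.isAlgebraic F (nonZeroDivisors R)
    rw [trdeg_eq_zero (R := R) (A := F), add_zero] at h
    rw [← h, htr]
  have : Algebra.EssFiniteType R F := Algebra.EssFiniteType.of_isLocalization F (nonZeroDivisors R)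
  have : Algebra.EssFiniteType K F := Algebra.EssFiniteType.comp K R F
  obtain ⟨D, ⟨z, hz⟩, hconst⟩ := aux_derivation htrF
  let a : Fin n → F := fun i => algebraMap R F (Ideal.Quotient.mk _ (X i))
  have ha : ∀ f, aeval a f = algebraMap R F (Ideal.Quotient.mk _ f) := by
    intro f
    have h := comp_aeval_apply (R := K) (X : Fin n → MvPolynomial (Fin n) K)
      ((IsScalarTower.toAlgHom K R F).comp (Ideal.Quotient.mkₐ K (vanishingIdeal K C))) f
    rw [aeval_X_left_apply] at h
    exact h.symm
  have hker : ∀ f, aeval a f = 0 ↔ f ∈ vanishingIdeal K C := by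
    intro f
    rw [ha, ← Ideal.Quotient.eq_zero_iff_mem]
    exact map_eq_zero_iff _ (IsFractionRing.injective R F)
  have hgen : ∀ z : F, ∃ p q : MvPolynomial (Fin n) K,
      aeval a q ≠ 0 ∧ z * aeval a q = aeval a p := by
    intro z
    obtain ⟨x, y, hy, rfl⟩ := IsFractionRing.div_surjective (A := R) z
    obtain ⟨p, rfl⟩ := Ideal.Quotient.mk_surjective x
    obtain ⟨q, rfl⟩ := Ideal.Quotient.mk_surjective y
    have hq : algebraMap R F (Ideal.Quotient.mk _ q) ≠ 0 :=
      IsFractionRing.to_map_ne_zero_of_mem_nonZeroDivisors hy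
    exact ⟨p, q, by rwa [ha], by rw [ha, ha, div_mul_cancel₀ _ hq]⟩
  obtain ⟨j, hj⟩ : ∃ j, D (a j) ≠ 0 := by
    by_contra! h
    have hp : ∀ p : MvPolynomial (Fin n) K, D (aeval a p) = 0 := by
      intro p
      rw [aux_chain]
      simp [h]
    obtain ⟨p, q, hq, hpq⟩ := hgen z
    have h1 := congrArg D hpq
    rw [Derivation.leibniz, hp, hp] at h1
    simp only [smul_eq_mul, mul_zero, zero_add] at h1
    exact (mul_ne_zero hq hz) h1
  obtain ⟨i, hi⟩ : ∃ i, Transcendental K (D (a i) / D (a j)) := by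
    by_contra! h
    exact hl (aux_line C hCalg a hker D hconst j hj fun i => not_not.1 (h i))
  have htwo := aux_trdeg_two htrF (fun k => D (a k)) i j hj hi
  set φ := aeval (R := K) (fun k => Polynomial.C (D (a k)) * Polynomial.X : Fin n → Polynomial F)
    with hφ
  have hJ : vanishingIdeal K (tangentialVariety C) = RingHom.ker φ := by
    ext f
    rw [RingHom.mem_ker, ← aux_ideal C hsm' a hker hgen D j hj f]
    constructor
    · intro h x hx
      exact h x (fun g hg => hg x hx)
    · intro h x hx
      exact hx f h
  have hJp : (vanishingIdeal K (tangentialVariety C)).IsPrime := by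
    rw [hJ]; exact RingHom.ker_isPrime φ
  have h3 := aux_dim (tangentialVariety C) hJp
  rw [hJ] at h3
  let e : (MvPolynomial (Fin n) K ⧸ RingHom.ker φ) ≃ₐ[K] φ.range := Ideal.quotientKerEquivRange φ
  have h4 : Algebra.trdeg K (MvPolynomial (Fin n) K ⧸ RingHom.ker φ) = Algebra.trdeg K φ.range :=
    AlgEquiv.trdeg_eq (A := MvPolynomial (Fin n) K ⧸ RingHom.ker φ) (A' := φ.range) e
  rw [h4, htwo] at h3
  exact_mod_cast h3.symm
end

section
/- Let C ⊆ A² be a smooth irreducible plane curve which is not a line. Then ω(C) = max over p ∈ C of the number of points q ∈ C such that T_qC = T_pC. -/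
open MvPolynomial

theorem aux_dim_s13 {S T : Type} [CommRing S] [IsDomain S] [CommRing T] (φ : S →+* T)
    (hφ : Function.Surjective φ) (g : S) (hg : g ≠ 0) (h : φ g = 0) :
    ringKrullDim T + 1 ≤ ringKrullDim S := by
  have h3 := ringKrullDim_quotient_succ_le_of_nonZeroDivisor (mem_nonZeroDivisors_of_ne_zero hg)
  refine le_trans ?_ h3
  gcongr
  refine ringKrullDim_le_of_surjective (Ideal.Quotient.lift (Ideal.span {g}) φ ?_)
    (Ideal.Quotient.lift_surjective_of_surjective _ _ hφ)
  intro a ha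
  obtain ⟨b, rfl⟩ := Ideal.mem_span_singleton'.1 ha
  rw [map_mul, h, mul_zero]

theorem aux_exists_gen {K : Type} [Field K] (P : Ideal (MvPolynomial (Fin 2) K)) [hP : P.IsPrime]
    (hd : ringKrullDim (MvPolynomial (Fin 2) K ⧸ P) = 1) :
    ∃ f : MvPolynomial (Fin 2) K, Irreducible f ∧ P = Ideal.span {f} := by
  have h2 : ringKrullDim (MvPolynomial (Fin 2) K) = 2 := by
    rw [MvPolynomial.ringKrullDim_of_isNoetherianRing]; simp
  have hne : P ≠ ⊥ := by
    rintro rfl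
    have := ringKrullDim_eq_of_ringEquiv (RingEquiv.quotientBot (MvPolynomial (Fin 2) K))
    rw [hd, h2] at this
    exact absurd this (by decide)
  obtain ⟨f, hfP, hf⟩ := hP.exists_mem_prime_of_ne_bot hne
  refine ⟨f, hf.irreducible, ?_⟩
  by_contra hcon
  have hle : Ideal.span {f} ≤ P := by rwa [Ideal.span_singleton_le_iff_mem]
  obtain ⟨g, hgP, hgf⟩ := SetLike.exists_of_lt (lt_of_le_of_ne hle (Ne.symm hcon))
  have hpr : (Ideal.span {f}).IsPrime := (Ideal.span_singleton_prime hf.ne_zero).2 hf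
  have h1 := ringKrullDim_quotient_succ_le_of_nonZeroDivisor (mem_nonZeroDivisors_of_ne_zero hf.ne_zero)
  have hg0 : Ideal.Quotient.mk (Ideal.span {f}) g ≠ 0 := by
    rwa [Ne, Ideal.Quotient.eq_zero_iff_mem]
  have h4 := aux_dim_s13 (Ideal.Quotient.factor hle) (Ideal.Quotient.factor_surjective hle) _ hg0
    (by rw [Ideal.Quotient.factor_mk, Ideal.Quotient.eq_zero_iff_mem.2 hgP])
  rw [hd] at h4
  rw [h2] at h1
  have h5 : (1 : WithBot ℕ∞) + 1 + 1 ≤ 2 := by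
    refine le_trans ?_ h1
    gcongr
  exact absurd h5 (by decide)

/-- the chain rule along a line -/
theorem aux_chain_s13 {K : Type} [Field K] (p v : Fin 2 → K) (f : MvPolynomial (Fin 2) K) :
    Polynomial.derivative (aeval (fun i => Polynomial.C (p i) + Polynomial.C (v i) * Polynomial.X) f) =
    aeval (fun i => Polynomial.C (p i) + Polynomial.C (v i) * Polynomial.X)
      (C (v 0) * pderiv 0 f + C (v 1) * pderiv 1 f) := by
  induction f using MvPolynomial.induction_on with
  | C a => simp
  | add f g hf hg => rw [map_add, map_add, hf, hg, ← map_add]; congr 1; simp only [map_add]; ring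
  | mul_X f i hf =>
    simp only [map_mul, map_add, Derivation.leibniz, Polynomial.derivative_mul, hf, aeval_X, aeval_C, pderiv_X, smul_eq_mul]
    fin_cases i <;> simp <;> ring

theorem aux_line_s13 {K : Type} [Field K] [CharZero K] (C' : Set (Fin 2 → K))
    (f : MvPolynomial (Fin 2) K) (hf : Irreducible f) (hC : C' = zeroLocus K (Ideal.span {f}))
    (p : Fin 2 → K) (hp : p ∈ C') (v : Fin 2 → K) (hv : v ≠ 0)
    (hd : f ∣ C (v 0) * pderiv 0 f + C (v 1) * pderiv 1 f) : IsLine C' := by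
  have hmem : ∀ z, z ∈ C' ↔ eval z f = 0 := by
    intro z
    rw [hC, zeroLocus_span]; simp [aeval_eq_eval]
  set g : Polynomial K := aeval (fun i => Polynomial.C (p i) + Polynomial.C (v i) * Polynomial.X) f with hg
  have hgev : ∀ s, g.eval s = eval (fun i => p i + v i * s) f := by
    intro s
    rw [hg, ← Polynomial.coe_evalRingHom, ← aeval_eq_eval]
    have := MvPolynomial.map_aeval (fun i => Polynomial.C (p i) + Polynomial.C (v i) * Polynomial.X) (Polynomial.evalRingHom s) f
    rw [this]
    simp [aeval_def, eval₂_eq']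
  have hdvd : g ∣ g.derivative := by
    rw [hg, aux_chain_s13]
    exact map_dvd _ hd
  have hg' : g.derivative = 0 := by
    by_contra h
    have h1 := Polynomial.natDegree_le_of_dvd hdvd h
    have h2 : g.natDegree ≠ 0 := by
      intro h0
      rw [Polynomial.eq_C_of_natDegree_eq_zero h0] at h
      simp at h
    have := Polynomial.natDegree_derivative_lt h2
    omega
  have hgc := Polynomial.eq_C_of_derivative_eq_zero hg'
  have hg0 : ∀ s, g.eval s = 0 := by
    have h0 : g.eval 0 = 0 := by rw [hgev]; simpa using (hmem p).1 hp
    intro s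
    rw [hgc] at h0 ⊢
    simpa using h0
  obtain ⟨w, hw⟩ : ∃ w : Fin 2 → K, w 0 * v 0 + w 1 * v 1 = 1 := by
    by_cases h0 : v 0 = 0
    · have h1 : v 1 ≠ 0 := by
        intro h1; apply hv; ext i; fin_cases i <;> simp [h0, h1]
      exact ⟨![0, (v 1)⁻¹], by simp [h1]⟩
    · exact ⟨![(v 0)⁻¹, 0], by simp [h0]⟩
  let l : MvPolynomial (Fin 2) K := C (v 1) * (X 0 - C (p 0)) - C (v 0) * (X 1 - C (p 1))
  let σ : Fin 2 → MvPolynomial (Fin 2) K := fun i =>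
    C (p i) + C (v i) * (C (w 0) * (X 0 - C (p 0)) + C (w 1) * (X 1 - C (p 1)))
  have hσ : bind₁ σ f = 0 := by
    apply MvPolynomial.funext
    intro z
    have := hg0 (w 0 * (z 0 - p 0) + w 1 * (z 1 - p 1))
    rw [hgev] at this
    rw [map_zero, ← this, ← aeval_eq_eval, aeval_bind₁, aeval_eq_eval]
    congr 1
    congr 1
    ext i
    simp [σ]
  have hCw : (C (w 0) * C (v 0) + C (w 1) * C (v 1) : MvPolynomial (Fin 2) K) = 1 := by
    rw [← C_mul, ← C_mul, ← C_add, hw, C_1]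
  have hl : l ∣ f := by
    rw [← Ideal.mem_span_singleton, ← Ideal.Quotient.eq_zero_iff_mem]
    have : (Ideal.Quotient.mkₐ K (Ideal.span {l})).comp (bind₁ σ) = Ideal.Quotient.mkₐ K (Ideal.span {l}) := by
      apply MvPolynomial.algHom_ext
      intro i
      simp only [AlgHom.comp_apply, bind₁_X_right, Ideal.Quotient.mkₐ_eq_mk]
      rw [eq_comm, Ideal.Quotient.mk_eq_mk_iff_sub_mem, Ideal.mem_span_singleton]
      fin_cases i
      · refine ⟨C (w 1), ?_⟩
        simp only [σ, l, Fin.zero_eta, Fin.mk_one]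
        linear_combination (-(X 0 - C (p 0))) * hCw
      · refine ⟨-C (w 0), ?_⟩
        simp only [σ, l, Fin.zero_eta, Fin.mk_one]
        linear_combination (-(X 1 - C (p 1))) * hCw
    have h2 := DFunLike.congr_fun this f
    simp only [AlgHom.comp_apply, hσ, map_zero] at h2
    exact h2.symm
  have hlu : ¬ IsUnit l := by
    intro h
    have := h.map (eval p)
    simp [l] at this
  have hfl : f ∣ l := by
    obtain ⟨k, hk⟩ := hl
    have := (hf.isUnit_or_isUnit hk).resolve_left hlu
    obtain ⟨u, rfl⟩ := this
    exact ⟨↑u⁻¹, by rw [hk, mul_assoc, Units.mul_inv, mul_one]⟩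
  refine ⟨AffineSubspace.mk' p (Submodule.span K {v}), ?_, ?_⟩
  · ext z
    rw [hmem, SetLike.mem_coe, AffineSubspace.mem_mk', Submodule.mem_span_singleton]
    constructor
    · intro hz
      have : eval z l = 0 := by
        obtain ⟨k, hk⟩ := hfl
        rw [hk, map_mul, hz, zero_mul]
      simp [l] at this
      refine ⟨w 0 * (z 0 - p 0) + w 1 * (z 1 - p 1), ?_⟩
      ext i
      fin_cases i
      · simp
        linear_combination (z 0 - p 0) * hw - w 1 * this
      · simp
        linear_combination (z 1 - p 1) * hw + w 0 * this
    · rintro ⟨s, hs⟩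
      have := hg0 s
      rw [hgev] at this
      have hz : z = fun i => p i + v i * s := by
        ext i
        have := congrFun hs i
        simp at this
        linear_combination -this
      rw [hz]
      exact this
  · rw [AffineSubspace.direction_mk', finrank_span_singleton hv]

/-- `AuxSp α ε l k`: the element `l` specializes to `k`. -/
def AuxSp {R L K : Type} [CommRing R] [Field L] [Field K] (α : R →+* L) (ε : R →+* K)
    (l : L) (k : K) : Prop :=
  ∃ a b, ε b ≠ 0 ∧ l * α b = α a ∧ ε a = k * ε b

section AuxSpSection

variable {R L K : Type} [CommRing R] [Field L] [Field K] {α : R →+* L} {ε : R →+* K}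

theorem AuxSp.of (r : R) : AuxSp α ε (α r) (ε r) := ⟨r, 1, by simp, by simp, by simp⟩

theorem AuxSp.add {l l' : L} {k k' : K} (h : AuxSp α ε l k) (h' : AuxSp α ε l' k') :
    AuxSp α ε (l + l') (k + k') := by
  obtain ⟨a, b, hb, h1, h2⟩ := h
  obtain ⟨a', b', hb', h1', h2'⟩ := h'
  refine ⟨a * b' + a' * b, b * b', by simp [hb, hb'], ?_, ?_⟩
  · simp only [map_add, map_mul]; linear_combination α b' * h1 + α b * h1'
  · simp only [map_add, map_mul]; linear_combination ε b' * h2 + ε b * h2'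

theorem AuxSp.mul {l l' : L} {k k' : K} (h : AuxSp α ε l k) (h' : AuxSp α ε l' k') :
    AuxSp α ε (l * l') (k * k') := by
  obtain ⟨a, b, hb, h1, h2⟩ := h
  obtain ⟨a', b', hb', h1', h2'⟩ := h'
  refine ⟨a * a', b * b', by simp [hb, hb'], ?_, ?_⟩
  · simp only [map_mul]; rw [← h1, ← h1']; ring
  · simp only [map_mul]; rw [h2, h2']; ring

theorem AuxSp.eq_zero (hk : ∀ r, α r = 0 → ε r = 0) {k : K} (h : AuxSp α ε 0 k) : k = 0 := by
  obtain ⟨a, b, hb, h1, h2⟩ := h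
  rw [zero_mul] at h1
  rw [hk a h1.symm] at h2
  simpa [hb] using h2.symm

theorem AuxSp.unique (hk : ∀ r, α r = 0 → ε r = 0) {l : L} {k k' : K} (h : AuxSp α ε l k)
    (h' : AuxSp α ε l k') : k = k' := by
  have h1 := h.add ((AuxSp.of (α := α) (ε := ε) (-1)).mul h')
  have : l + α (-1) * l = 0 := by simp
  rw [this] at h1
  have := h1.eq_zero hk
  simp at this
  linear_combination this

theorem AuxSp.sum {ι : Type} (s : Finset ι) (l : ι → L) (k : ι → K)
    (h : ∀ i ∈ s, AuxSp α ε (l i) (k i)) : AuxSp α ε (∑ i ∈ s, l i) (∑ i ∈ s, k i) := by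
  classical
  induction s using Finset.induction_on with
  | empty => simpa using AuxSp.of (α := α) (ε := ε) 0
  | insert a s ha ih =>
    rw [Finset.sum_insert ha, Finset.sum_insert ha]
    exact (h a (by simp)).add (ih fun i hi => h i (by simp [hi]))

variable [Algebra K L]

theorem AuxSp.poly (hc : ∀ c : K, AuxSp α ε (algebraMap K L c) c) {l : L} {k : K}
    (h : AuxSp α ε l k) (p : Polynomial K) : AuxSp α ε (Polynomial.aeval l p) (p.eval k) := by
  induction p using Polynomial.induction_on with
  | C a => simpa using hc a
  | add p q hp hq => simpa using hp.add hq
  | monomial n a ih =>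
    have := ih.mul h
    simpa [pow_succ, mul_assoc] using this

theorem AuxSp.mvpoly (hc : ∀ c : K, AuxSp α ε (algebraMap K L c) c) {l : Fin 2 → L} {k : Fin 2 → K}
    (h : ∀ i, AuxSp α ε (l i) (k i)) (p : MvPolynomial (Fin 2) K) :
    AuxSp α ε (aeval l p) (eval k p) := by
  induction p using MvPolynomial.induction_on with
  | C a => simpa using hc a
  | add p q hp hq => simpa using hp.add hq
  | mul_X p i ih => simpa using ih.mul (h i)

end AuxSpSection

theorem aux_interp {K : Type} [Field K] (s : Finset (Fin 2 → K)) (q : Fin 2 → K) :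
    ∃ g : MvPolynomial (Fin 2) K, eval q g ≠ 0 ∧ ∀ q' ∈ s, q' ≠ q → eval q' g = 0 := by
  classical
  have h : ∀ q' : Fin 2 → K, ∃ g : MvPolynomial (Fin 2) K, eval q g ≠ 0 ∧ (q' ≠ q → eval q' g = 0) := by
    intro q'
    by_cases hq : q' = q
    · exact ⟨1, by simp, fun h => absurd hq h⟩
    · obtain ⟨i, hi⟩ := Function.ne_iff.1 hq
      exact ⟨X i - C (q' i), by simpa [sub_eq_zero] using hi.symm, by simp⟩
  choose g hg hg' using h
  refine ⟨∏ q' ∈ s, g q', ?_, ?_⟩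
  · rw [map_prod]; exact Finset.prod_ne_zero_iff.2 fun q' _ => hg q'
  · intro q' hq' hne
    rw [map_prod]
    exact Finset.prod_eq_zero hq' (hg' q' hne)

open IntermediateField IntermediateField.algebraAdjoinAdjoin in
theorem aux_upper {L K : Type} [Field L] [Field K] [Algebra K L]
    (x : Fin 2 → L) (u : L) (hu : u ≠ 0) [FiniteDimensional K⟮u⟯ L]
    (s : Finset (Fin 2 → K))
    (hs : ∀ q ∈ s, (∀ r : MvPolynomial (Fin 2) K, aeval x r = 0 → eval q r = 0) ∧
      AuxSp (aeval x : MvPolynomial (Fin 2) K →ₐ[K] L).toRingHom (eval q) u 0) :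
    s.card ≤ Module.finrank K⟮u⟯ L := by
  classical
  choose g hg hg' using aux_interp s
  have key : ∀ n : ℕ, ∀ c : s → Polynomial K, (∀ i, (c i).degree < n) →
      ∑ i, Polynomial.aeval u (c i) * aeval x (g i) = 0 → ∀ i, c i = 0 := by
    intro n
    induction n with
    | zero =>
      intro c hc _ i
      have := hc i
      simpa [Nat.WithBot.lt_zero_iff] using this
    | succ n ih =>
      intro c hc hsum
      have h0 : ∀ i, (c i).eval 0 = 0 := by
        intro i
        obtain ⟨hk, hu0⟩ := hs i i.2
        have hconst : ∀ a : K, AuxSp (aeval x : MvPolynomial (Fin 2) K →ₐ[K] L).toRingHom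
            (eval (i : Fin 2 → K)) (algebraMap K L a) a := by
          intro a
          simpa using AuxSp.of (α := (aeval x : MvPolynomial (Fin 2) K →ₐ[K] L).toRingHom)
            (ε := eval (i : Fin 2 → K)) (C a)
        have h1 := AuxSp.sum Finset.univ (fun j : s => Polynomial.aeval u (c j) * aeval x (g j))
          (fun j : s => (c j).eval 0 * eval (i : Fin 2 → K) (g j))
          (fun j _ => (AuxSp.poly hconst hu0 (c j)).mul (AuxSp.of (g j)))
        rw [hsum] at h1
        have h2 := h1.eq_zero hk
        rw [Finset.sum_eq_single i] at h2
        · exact (mul_eq_zero.1 h2).resolve_right (hg i)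
        · intro j _ hj
          rw [hg' j i i.2 (fun h => hj (Subtype.ext h.symm)), mul_zero]
        · simp
      have hX : ∀ i, ∃ e, c i = Polynomial.X * e := by
        intro i
        rw [← dvd_def, Polynomial.X_dvd_iff, Polynomial.coeff_zero_eq_eval_zero, h0]
      choose e he using hX
      have he0 : ∀ i, e i = 0 := by
        apply ih
        · intro i
          have := hc i
          rw [he i] at this
          by_cases h : e i = 0
          · rw [h, Polynomial.degree_zero]; exact WithBot.bot_lt_coe _
          · rw [Polynomial.degree_mul, Polynomial.degree_X, Polynomial.degree_eq_natDegree h] at this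
            rw [Polynomial.degree_eq_natDegree h]
            norm_cast at this ⊢
            omega
        · have : u * ∑ i, Polynomial.aeval u (e i) * aeval x (g i) = 0 := by
            rw [← hsum, Finset.mul_sum]
            refine Finset.sum_congr rfl fun i _ => ?_
            rw [he i]; simp; ring
          exact (mul_eq_zero.1 this).resolve_left hu
      intro i
      rw [he i, he0 i, mul_zero]
  have hli : LinearIndependent (Algebra.adjoin K {u}) (fun i : s => aeval x (g i)) := by
    rw [Fintype.linearIndependent_iff]
    intro c hc i
    have : ∀ i, ∃ p : Polynomial K, Polynomial.aeval u p = (c i : L) := by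
      intro i
      have h : ∀ z ∈ Algebra.adjoin K {u}, ∃ p : Polynomial K, Polynomial.aeval u p = z := by
        intro z hz
        rw [Algebra.adjoin_singleton_eq_range_aeval] at hz
        exact hz
      exact h _ (c i).2
    choose p hp using this
    have := key ((Finset.univ.sup fun i => (p i).natDegree) + 1) p (fun i => by
      refine lt_of_le_of_lt Polynomial.degree_le_natDegree ?_
      have := Finset.le_sup (f := fun i => (p i).natDegree) (Finset.mem_univ i)
      norm_cast
      omega) (by
        rw [← hc]
        refine Finset.sum_congr rfl fun i _ => ?_
        rw [hp]; rfl) i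
    ext
    rw [← hp, this]; simp
  have hli' : LinearIndependent K⟮u⟯ (fun i : s => aeval x (g i)) :=
    (LinearIndependent.iff_fractionRing (Algebra.adjoin K {u}) K⟮u⟯).1 hli
  simpa using hli'.fintype_card_le_finrank

open Polynomial in
theorem aux_clear_s13 {K L E : Type} [Field K] [Field L] [Field E]
    [Algebra K[X] E] [IsFractionRing K[X] E] [Algebra E L] [Algebra K[X] L] [IsScalarTower K[X] E L]
    [FiniteDimensional E L] (θ : L) (hθ : IntermediateField.adjoin E {θ} = ⊤) (l : L) :
    ∃ h : K[X], h ≠ 0 ∧ ∃ p : K[X][X], l * algebraMap K[X] L h = Polynomial.aeval θ p := by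
  have h1 : l ∈ (IntermediateField.adjoin E {θ}).toSubalgebra := by rw [hθ]; trivial
  rw [IntermediateField.adjoin_simple_toSubalgebra_of_isAlgebraic (Algebra.IsAlgebraic.isAlgebraic θ),
    Algebra.adjoin_singleton_eq_range_aeval] at h1
  obtain ⟨p, rfl⟩ := h1
  obtain ⟨b, hb, hb'⟩ := IsLocalization.integerNormalization_spec (nonZeroDivisors K[X]) p
  refine ⟨b, nonZeroDivisors.ne_zero hb, IsLocalization.integerNormalization (nonZeroDivisors K[X]) p, ?_⟩
  rw [← Polynomial.aeval_map_algebraMap E, hb']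
  rw [← IsScalarTower.algebraMap_smul E b p, map_smul, Algebra.smul_def, ← IsScalarTower.algebraMap_apply,
    mul_comm]
  rfl

open Polynomial in
theorem aux_lower {K L E : Type} [Field K] [IsAlgClosed K] [CharZero K] [Field L] [Field E]
    [Algebra K[X] E] [IsFractionRing K[X] E] [Algebra E L] [Algebra K[X] L] [IsScalarTower K[X] E L]
    [FiniteDimensional E L] [Algebra K L] [IsScalarTower K K[X] L] (x : Fin 2 → L)
    (hx : ∀ l : L, ∃ r s : MvPolynomial (Fin 2) K, MvPolynomial.aeval x s ≠ 0 ∧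
      l * MvPolynomial.aeval x s = MvPolynomial.aeval x r) :
    ∃ H : K[X], H ≠ 0 ∧ ∀ t : K, H.eval t ≠ 0 → ∃ S : Finset (Fin 2 → K),
      S.card = Module.finrank E L ∧ ∀ q ∈ S, ∀ g g' : MvPolynomial (Fin 2) K,
        MvPolynomial.aeval x g + algebraMap K[X] L X * MvPolynomial.aeval x g' = 0 →
        MvPolynomial.eval q g + t * MvPolynomial.eval q g' = 0 := by
  classical
  have : CharZero E := by
    have : CharZero K[X] := inferInstance
    exact charZero_of_injective_algebraMap (IsFractionRing.injective K[X] E)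
  have hinjL : Function.Injective (algebraMap K[X] L) := by
    rw [IsScalarTower.algebraMap_eq K[X] E L]
    exact (algebraMap E L).injective.comp (IsFractionRing.injective K[X] E)
  have : FaithfulSMul K[X] L := (faithfulSMul_iff_algebraMap_injective _ _).2 hinjL
  obtain ⟨θ, h_integral, hθ⟩ : ∃ θ : L, IsIntegral K[X] θ ∧ IntermediateField.adjoin E {θ} = ⊤ := by
    obtain ⟨θ, hθ⟩ := Field.exists_primitive_element E L
    have halg : IsAlgebraic K[X] θ :=
      (IsFractionRing.isAlgebraic_iff K[X] E L).2 (Algebra.IsAlgebraic.isAlgebraic θ)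
    obtain ⟨y, hy, hy'⟩ := halg.exists_integral_multiple
    refine ⟨y • θ, hy', ?_⟩
    rw [eq_top_iff, ← hθ, IntermediateField.adjoin_simple_le_iff]
    have h1 := IntermediateField.mem_adjoin_simple_self E (y • θ)
    have h2 := IntermediateField.smul_mem _ h1 (x := (algebraMap K[X] E y)⁻¹)
    have hy0 : algebraMap K[X] E y ≠ 0 := by
      intro h; exact hy ((IsFractionRing.injective K[X] E) (by rw [h, map_zero]))
    rwa [show (algebraMap K[X] E y)⁻¹ • (y • θ) = θ by
      rw [← IsScalarTower.algebraMap_smul E y θ, smul_smul, inv_mul_cancel₀ hy0, one_smul]] at h2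
  set P := minpoly K[X] θ with hP
  have hPm : P.Monic := minpoly.monic h_integral
  have hPE : minpoly E θ = P.map (algebraMap K[X] E) :=
    minpoly.isIntegrallyClosed_eq_field_fractions' E h_integral
  have hdeg : P.natDegree = Module.finrank E L := by
    rw [← IntermediateField.finrank_top', ← hθ, IntermediateField.adjoin.finrank (Algebra.IsIntegral.isIntegral θ),
      hPE, hPm.natDegree_map]
  have hder : aeval θ (derivative P) ≠ 0 := by
    have := (Algebra.IsSeparable.isSeparable E θ).aeval_derivative_ne_zero (minpoly.aeval E θ)
    rwa [hPE, derivative_map, Polynomial.aeval_map_algebraMap] at this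
  obtain ⟨r, s, hs0, hrs⟩ := hx θ
  obtain ⟨h0, hh0, p0, hp0⟩ := aux_clear_s13 (K := K) (E := E) θ hθ (x 0)
  obtain ⟨h1, hh1, p1, hp1⟩ := aux_clear_s13 (K := K) (E := E) θ hθ (x 1)
  obtain ⟨h2, hh2, p2, hp2⟩ := aux_clear_s13 (K := K) (E := E) θ hθ ((aeval θ (derivative P))⁻¹)
  obtain ⟨h3, hh3, p3, hp3⟩ := aux_clear_s13 (K := K) (E := E) θ hθ ((MvPolynomial.aeval x s)⁻¹)
  refine ⟨h0 * h1 * h2 * h3, by simp [hh0, hh1, hh2, hh3], ?_⟩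
  intro t ht
  have ht : (h0.eval t ≠ 0 ∧ h1.eval t ≠ 0) ∧ h2.eval t ≠ 0 ∧ h3.eval t ≠ 0 := by
    simp only [Polynomial.eval_mul, mul_ne_zero_iff] at ht
    tauto
  obtain ⟨⟨ht0, ht1⟩, ht2, ht3⟩ := ht
  set Q : K[X] := P.map (evalRingHom t) with hQ
  have hQm : Q.Monic := hPm.map _
  have hQe : ∀ y, evalEval t y P = Q.eval y := by
    intro y
    rw [hQ, Polynomial.eval_map, ← coe_evalEvalRingHom, evalEvalRingHom_eq, coe_eval₂RingHom]
  have hQe' : ∀ y, evalEval t y (derivative P) = (derivative Q).eval y := by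
    intro y
    rw [hQ, derivative_map, Polynomial.eval_map, ← coe_evalEvalRingHom, evalEvalRingHom_eq, coe_eval₂RingHom]
  let α : K[X][X] →+* L := (aeval θ : K[X][X] →ₐ[K[X]] L).toRingHom
  have hα : ∀ p, α p = aeval θ p := fun p => rfl
  have hker : ∀ y ∈ Q.roots, ∀ p, α p = 0 → evalEvalRingHom t y p = 0 := by
    intro y hy p hp
    obtain ⟨c, rfl⟩ := minpoly.isIntegrallyClosed_dvd h_integral hp
    rw [map_mul, ← hP]
    have : evalEvalRingHom t y P = 0 := by
      rw [coe_evalEvalRingHom, hQe]; exact (mem_roots'.1 hy).2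
    rw [this, zero_mul]
  have hsp : ∀ (l : L) (h : K[X]) (p : K[X][X]) (y : K), h.eval t ≠ 0 →
      l * algebraMap K[X] L h = aeval θ p → ∃ k, AuxSp α (evalEvalRingHom t y) l k := by
    intro l h p y hh hlp
    refine ⟨evalEval t y p / h.eval t, p, Polynomial.C h, ?_, ?_, ?_⟩
    · simpa using hh
    · rw [hα, hα, ← hlp, Polynomial.aeval_C]
    · simp [hh]
  have hconst : ∀ y c, AuxSp α (evalEvalRingHom t y) (algebraMap K L c) c := by
    intro y c
    have := AuxSp.of (α := α) (ε := evalEvalRingHom t y) (Polynomial.C (Polynomial.C c))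
    rw [hα, Polynomial.aeval_C] at this
    rw [IsScalarTower.algebraMap_apply K K[X] L]
    simpa using this
  have hone : ∀ y, AuxSp α (evalEvalRingHom t y) 1 1 := by
    intro y; simpa using hconst y 1
  have hX : ∀ y, AuxSp α (evalEvalRingHom t y) (algebraMap K[X] L X) t := by
    intro y
    have := AuxSp.of (α := α) (ε := evalEvalRingHom t y) (Polynomial.C X)
    rw [hα, Polynomial.aeval_C] at this
    simpa using this
  have hY : ∀ y, AuxSp α (evalEvalRingHom t y) θ y := by
    intro y
    have := AuxSp.of (α := α) (ε := evalEvalRingHom t y) X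
    rw [hα, Polynomial.aeval_X] at this
    simpa using this
  have hnodup : Q.roots.Nodup := by
    rw [Multiset.nodup_iff_count_le_one]
    intro y
    rw [count_roots]
    by_contra hcon
    rw [not_le, one_lt_rootMultiplicity_iff_isRoot hQm.ne_zero] at hcon
    have hy : y ∈ Q.roots := (mem_roots hQm.ne_zero).2 hcon.1
    obtain ⟨k, hk⟩ := hsp _ h2 p2 y ht2 hp2
    have h4 := (AuxSp.of (α := α) (ε := evalEvalRingHom t y) (derivative P)).mul hk
    rw [hα, mul_inv_cancel₀ hder] at h4
    have h5 := h4.unique (hker y hy) (hone y)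
    rw [coe_evalEvalRingHom, hQe', hcon.2] at h5
    simp at h5
  have hpt : ∀ y, ∃ q : Fin 2 → K, ∀ i, AuxSp α (evalEvalRingHom t y) (x i) (q i) := by
    intro y
    obtain ⟨a, ha⟩ := hsp _ h0 p0 y ht0 hp0
    obtain ⟨b, hb⟩ := hsp _ h1 p1 y ht1 hp1
    refine ⟨![a, b], fun i => ?_⟩
    fin_cases i
    · exact ha
    · exact hb
  choose q hq using hpt
  have hθq : ∀ y ∈ Q.roots, MvPolynomial.eval (q y) s ≠ 0 ∧
      y * MvPolynomial.eval (q y) s = MvPolynomial.eval (q y) r := by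
    intro y hy
    constructor
    · intro h
      obtain ⟨k, hk⟩ := hsp _ h3 p3 y ht3 hp3
      have h4 := (AuxSp.mvpoly (hconst y) (hq y) s).mul hk
      rw [mul_inv_cancel₀ hs0] at h4
      have h5 := h4.unique (hker y hy) (hone y)
      rw [h] at h5
      simp at h5
    · have h4 := (hY y).mul (AuxSp.mvpoly (hconst y) (hq y) s)
      rw [hrs] at h4
      exact h4.unique (hker y hy) (AuxSp.mvpoly (hconst y) (hq y) r)
  refine ⟨Q.roots.toFinset.image q, ?_, ?_⟩
  · rw [Finset.card_image_of_injOn, Multiset.toFinset_card_of_nodup hnodup,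
      ← (IsAlgClosed.splits Q).natDegree_eq_card_roots, hQ, hPm.natDegree_map, hdeg]
    intro y hy y' hy' hyy
    have hy : y ∈ Q.roots := by simpa using hy
    have hy' : y' ∈ Q.roots := by simpa using hy'
    obtain ⟨e1, e2⟩ := hθq y hy
    obtain ⟨e1', e2'⟩ := hθq y' hy'
    rw [hyy] at e1 e2
    exact mul_right_cancel₀ e1 (e2.trans e2'.symm)
  · intro q' hq' g g' hg
    obtain ⟨y, hy, rfl⟩ := Finset.mem_image.1 hq'
    have hy : y ∈ Q.roots := by simpa using hy
    have h4 := (AuxSp.mvpoly (hconst y) (hq y) g).add ((hX y).mul (AuxSp.mvpoly (hconst y) (hq y) g'))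
    rw [hg] at h4
    exact h4.eq_zero (hker y hy)

open IntermediateField IntermediateField.algebraAdjoinAdjoin in
theorem aux_lower' {K L : Type} [Field K] [IsAlgClosed K] [CharZero K] [Field L] [Algebra K L]
    (t : L) (ht : Transcendental K t) [FiniteDimensional K⟮t⟯ L] (x : Fin 2 → L)
    (hx : ∀ l : L, ∃ r s : MvPolynomial (Fin 2) K, MvPolynomial.aeval x s ≠ 0 ∧
      l * MvPolynomial.aeval x s = MvPolynomial.aeval x r) :
    ∃ H : Polynomial K, H ≠ 0 ∧ ∀ a : K, H.eval a ≠ 0 → ∃ S : Finset (Fin 2 → K),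
      S.card = Module.finrank K⟮t⟯ L ∧ ∀ q ∈ S, ∀ g g' : MvPolynomial (Fin 2) K,
        MvPolynomial.aeval x g + t * MvPolynomial.aeval x g' = 0 →
        MvPolynomial.eval q g + a * MvPolynomial.eval q g' = 0 := by
  let _ : Algebra (Polynomial K) L := (Polynomial.aeval t : Polynomial K →ₐ[K] L).toRingHom.toAlgebra
  let _ : Algebra (Polynomial K) K⟮t⟯ :=
    (Polynomial.aeval (AdjoinSimple.gen K t) : Polynomial K →ₐ[K] K⟮t⟯).toRingHom.toAlgebra
  have hL : ∀ p : Polynomial K, algebraMap (Polynomial K) L p = Polynomial.aeval t p := fun p => rfl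
  have hE : ∀ p : Polynomial K, algebraMap (Polynomial K) K⟮t⟯ p =
      Polynomial.aeval (AdjoinSimple.gen K t) p := fun p => rfl
  have hLE : ∀ p : Polynomial K, algebraMap (Polynomial K) L p =
      algebraMap K⟮t⟯ L (algebraMap (Polynomial K) K⟮t⟯ p) := by
    intro p
    rw [hL, hE, ← Polynomial.aeval_algebraMap_apply, AdjoinSimple.algebraMap_gen]
  have : IsScalarTower (Polynomial K) K⟮t⟯ L := IsScalarTower.of_algebraMap_eq hLE
  have : IsScalarTower K (Polynomial K) L := IsScalarTower.of_algebraMap_eq (by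
    intro c; rw [hL, Polynomial.algebraMap_eq, Polynomial.aeval_C])
  have : IsFractionRing (Polynomial K) K⟮t⟯ := by
    have : FaithfulSMul (Polynomial K) K⟮t⟯ := by
      rw [faithfulSMul_iff_algebraMap_injective]
      have hi : Function.Injective (algebraMap (Polynomial K) L) :=
        transcendental_iff_injective.1 ht
      intro p q hpq
      apply hi
      rw [hLE, hLE, hpq]
    apply IsFractionRing.of_field
    rintro ⟨z, hz⟩
    obtain ⟨r, s, hrs⟩ := (mem_adjoin_simple_iff K z).1 hz
    refine ⟨r, s, ?_⟩
    apply (algebraMap K⟮t⟯ L).injective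
    rw [map_div₀, ← hLE, ← hLE, hL, hL, ← hrs]
    rfl
  have := aux_lower (E := K⟮t⟯) x hx
  simpa [hL] using this

open IntermediateField in
theorem aux_upper' {L K : Type} [Field L] [Field K] [Algebra K L]
    (x : Fin 2 → L) (u : L) (hu : u ≠ 0) (E : IntermediateField K L) (hE : K⟮u⟯ = E)
    [FiniteDimensional E L]
    (s : Finset (Fin 2 → K))
    (hs : ∀ q ∈ s, (∀ r : MvPolynomial (Fin 2) K, aeval x r = 0 → eval q r = 0) ∧
      AuxSp (aeval x : MvPolynomial (Fin 2) K →ₐ[K] L).toRingHom (eval q) u 0) :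
    s.card ≤ Module.finrank E L := by
  subst hE
  exact aux_upper x u hu s hs

open IntermediateField in
theorem aux_finite {L K : Type} [Field L] [Field K] [Algebra K L]
    (x : Fin 2 → L)
    (hx : ∀ l : L, ∃ r s : MvPolynomial (Fin 2) K, MvPolynomial.aeval x s ≠ 0 ∧
      l * MvPolynomial.aeval x s = MvPolynomial.aeval x r)
    (f : MvPolynomial (Fin 2) K) (hf : f ≠ 0) (hfx : aeval x f = 0)
    (t : L) (ht : Transcendental K t) : FiniteDimensional K⟮t⟯ L := by
  have halg : Algebra.IsAlgebraic (Algebra.adjoin K (Set.range x)) L := by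
    constructor
    intro l
    obtain ⟨r, s, hs, hrs⟩ := hx l
    have hmem : ∀ r : MvPolynomial (Fin 2) K, aeval x r ∈ Algebra.adjoin K (Set.range x) := by
      intro r
      rw [Algebra.adjoin_range_eq_range_aeval]
      exact ⟨r, rfl⟩
    refine ⟨Polynomial.C ⟨aeval x s, hmem s⟩ * Polynomial.X - Polynomial.C ⟨aeval x r, hmem r⟩, ?_, ?_⟩
    · intro h
      have := congrArg (fun p => Polynomial.coeff p 1) h
      simp [Polynomial.coeff_C] at this
      exact hs (congrArg Subtype.val this)
    · simp only [map_sub, map_mul, Polynomial.aeval_C, Polynomial.aeval_X]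
      rw [sub_eq_zero, mul_comm]
      exact hrs
  have htr : Algebra.trdeg K L ≤ 1 := by
    by_contra hcon
    rw [not_le] at hcon
    have h2 : Cardinal.mk (Fin 2) ≤ Algebra.trdeg K L := by
      have := Order.succ_le_of_lt hcon
      simp
      refine le_trans (le_of_eq ?_) this
      have h5 := Cardinal.succ_natCast.{0} 1
      rw [Nat.cast_one] at h5
      rw [h5, one_add_one_eq_two]
    have h3 := Algebra.IsAlgebraic.isTranscendenceBasis_of_le_trdeg_of_finite K x h2
    have h4 := h3.1
    exact hf (h4 (by rw [hfx, map_zero]))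
  have hai : AlgebraicIndependent K (fun _ : Unit => t) := by
    rw [algebraicIndependent_unique_type_iff]; exact ht
  have htb := hai.isTranscendenceBasis_of_trdeg_le_of_finite (by simpa using htr)
  have hal := htb.isAlgebraic_field
  rw [Set.range_const] at hal
  have hfd : FiniteDimensional K⟮t⟯ (IntermediateField.adjoin K⟮t⟯ (Set.range x)) :=
    IntermediateField.finiteDimensional_adjoin (fun z _ => (Algebra.IsAlgebraic.isAlgebraic z).isIntegral)
  have htop : IntermediateField.adjoin K⟮t⟯ (Set.range x) = ⊤ := by
    rw [eq_top_iff]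
    intro l _
    obtain ⟨r, s, hs, hrs⟩ := hx l
    have hmem : ∀ r : MvPolynomial (Fin 2) K, aeval x r ∈ IntermediateField.adjoin K⟮t⟯ (Set.range x) := by
      intro r
      induction r using MvPolynomial.induction_on with
      | C a =>
        rw [aeval_C, IsScalarTower.algebraMap_apply K K⟮t⟯ L]
        exact IntermediateField.algebraMap_mem _ _
      | add p q hp hq => rw [map_add]; exact add_mem hp hq
      | mul_X p i hp =>
        rw [map_mul, aeval_X]
        exact mul_mem hp (IntermediateField.subset_adjoin _ _ ⟨i, rfl⟩)
    rw [eq_div_of_mul_eq hs hrs]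
    exact div_mem (hmem r) (hmem s)
  rw [htop] at hfd
  exact Module.Finite.equiv (IntermediateField.topEquiv (F := K⟮t⟯) (E := L)).toLinearEquiv

theorem aux_core {K : Type} [Field K] [IsAlgClosed K] [CharZero K] (f : MvPolynomial (Fin 2) K)
    (hf : Irreducible f)
    (hnd : ∀ v : Fin 2 → K, v ≠ 0 → ¬ f ∣ C (v 0) * pderiv 0 f + C (v 1) * pderiv 1 f)
    (hsm : ∀ q, eval q f = 0 → ¬ (eval q (pderiv 0 f) = 0 ∧ eval q (pderiv 1 f) = 0)) :
    ∃ d : ℕ, 0 < d ∧ ∃ H : Polynomial K, H ≠ 0 ∧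
      (∀ v : Fin 2 → K, v ≠ 0 → ∀ S : Finset (Fin 2 → K),
        (∀ q ∈ S, eval q f = 0 ∧ v 0 * eval q (pderiv 0 f) + v 1 * eval q (pderiv 1 f) = 0) →
        S.card ≤ d) ∧
      (∀ a : K, H.eval a ≠ 0 → ∃ S : Finset (Fin 2 → K), S.card = d ∧
        ∀ q ∈ S, eval q f = 0 ∧ eval q (pderiv 0 f) + a * eval q (pderiv 1 f) = 0) := by
  have hpr : (Ideal.span {f}).IsPrime := (Ideal.span_singleton_prime hf.ne_zero).2 hf.prime
  obtain ⟨L, _, _, x, hker, hx⟩ : ∃ (L : Type) (_ : Field L) (_ : Algebra K L) (x : Fin 2 → L),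
      (∀ r : MvPolynomial (Fin 2) K, aeval x r = 0 ↔ f ∣ r) ∧
      (∀ l : L, ∃ r s : MvPolynomial (Fin 2) K, MvPolynomial.aeval x s ≠ 0 ∧
        l * MvPolynomial.aeval x s = MvPolynomial.aeval x r) := by
    let A := MvPolynomial (Fin 2) K ⧸ Ideal.span {f}
    let mk : MvPolynomial (Fin 2) K →ₐ[K] A := Ideal.Quotient.mkₐ K (Ideal.span {f})
    let x : Fin 2 → FractionRing A := fun i => algebraMap A (FractionRing A) (mk (X i))
    have hx : ∀ r, aeval x r = algebraMap A (FractionRing A) (mk r) := by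
      intro r
      have : (aeval x : MvPolynomial (Fin 2) K →ₐ[K] FractionRing A) =
          (IsScalarTower.toAlgHom K A (FractionRing A)).comp mk := by
        apply MvPolynomial.algHom_ext
        intro i
        simp [x]
      rw [this]; rfl
    refine ⟨FractionRing A, inferInstance, inferInstance, x, ?_, ?_⟩
    · intro r
      rw [hx, ← Ideal.mem_span_singleton, ← Ideal.Quotient.eq_zero_iff_mem,
        FaithfulSMul.algebraMap_eq_zero_iff]
      rfl
    · intro l
      obtain ⟨a, b, hb, rfl⟩ := IsFractionRing.div_surjective (A := A) l
      obtain ⟨a, rfl⟩ := Ideal.Quotient.mk_surjective a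
      obtain ⟨b, rfl⟩ := Ideal.Quotient.mk_surjective b
      have hb0 : algebraMap A (FractionRing A) (Ideal.Quotient.mk _ b) ≠ 0 :=
        IsFractionRing.to_map_ne_zero_of_mem_nonZeroDivisors hb
      refine ⟨a, b, ?_, ?_⟩
      · rw [hx]; exact hb0
      · rw [hx, hx]; exact div_mul_cancel₀ _ hb0
  have hfx0 : aeval x (pderiv 0 f) ≠ 0 := by
    rw [Ne, hker]
    have := hnd ![1, 0] (by intro h; simpa using congrFun h 0)
    simpa using this
  have hfy0 : aeval x (pderiv 1 f) ≠ 0 := by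
    rw [Ne, hker]
    have := hnd ![0, 1] (by intro h; simpa using congrFun h 1)
    simpa using this
  set fx := aeval x (pderiv 0 f) with hfx
  set fy := aeval x (pderiv 1 f) with hfy
  let t : L := -fx / fy
  have htd : fx + t * fy = 0 := by simp only [t]; field_simp; ring
  have ht0 : t ≠ 0 := div_ne_zero (neg_ne_zero.2 hfx0) hfy0
  have ht : Transcendental K t := by
    intro halg
    have : t ∈ (⊥ : Subalgebra K L) := by
      have h1 : minpoly K t ∣ minpoly K t := dvd_rfl
      have h2 := IsAlgClosed.degree_eq_one_of_irreducible K (minpoly.irreducible halg.isIntegral)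
      exact minpoly.mem_range_of_degree_eq_one K t h2
    obtain ⟨c, hc⟩ := Algebra.mem_bot.1 this
    refine hnd ![1, c] (by intro h; simpa using congrFun h 0) ?_
    rw [← hker]
    simp only [Matrix.cons_val_zero, Matrix.cons_val_one, map_add, map_mul, aeval_C, map_one, one_mul]
    rw [hc]; exact htd
  have hfin := aux_finite x hx f hf.ne_zero ((hker f).2 dvd_rfl) t ht
  obtain ⟨H, hH, hH'⟩ := aux_lower' t ht x hx
  refine ⟨Module.finrank (IntermediateField.adjoin K {t}) L, Module.finrank_pos, H, hH, ?_, ?_⟩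
  · intro v hv S hS
    have hev : ∀ q ∈ S, ∀ r : MvPolynomial (Fin 2) K, aeval x r = 0 → eval q r = 0 := by
      intro q hq r hr
      obtain ⟨c, rfl⟩ := (hker r).1 hr
      rw [map_mul, (hS q hq).1, zero_mul]
    by_cases h0 : v 0 = 0
    · have h1 : v 1 ≠ 0 := by
        intro h1; apply hv; ext i; fin_cases i <;> simp [h0, h1]
      have h1' : algebraMap K L (v 1) ≠ 0 := by simpa using h1
      refine aux_upper' x (algebraMap K L (v 1) * t⁻¹) (mul_ne_zero h1' (inv_ne_zero ht0)) _ ?_ S ?_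
      · apply le_antisymm
        · rw [IntermediateField.adjoin_simple_le_iff]
          exact mul_mem (IntermediateField.algebraMap_mem _ _)
            (inv_mem (IntermediateField.mem_adjoin_simple_self K t))
        · rw [IntermediateField.adjoin_simple_le_iff]
          have h2 := mul_mem (IntermediateField.algebraMap_mem _ (v 1)) (inv_mem (IntermediateField.mem_adjoin_simple_self K
            (algebraMap K L (v 1) * t⁻¹)))
          convert h2 using 1
          field_simp
      · intro q hq
        refine ⟨hev q hq, ?_⟩
        obtain ⟨e1, e2⟩ := hS q hq
        rw [h0, zero_mul, zero_add] at e2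
        have e3 := (mul_eq_zero.1 e2).resolve_left h1
        refine ⟨-C (v 1) * pderiv 1 f, pderiv 0 f, fun h => hsm q e1 ⟨h, e3⟩, ?_, by simp [e3]⟩
        change algebraMap K L (v 1) * t⁻¹ * aeval x (pderiv 0 f) = aeval x (-C (v 1) * pderiv 1 f)
        simp only [map_mul, map_neg, aeval_C, ← hfx, ← hfy]
        field_simp
        linear_combination htd
    · have h0' : algebraMap K L (v 0) ≠ 0 := by simpa using h0
      refine aux_upper' x (algebraMap K L (v 1) - algebraMap K L (v 0) * t) ?_ _ ?_ S ?_
      · intro h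
        apply ht
        have : t = algebraMap K L (v 1 / v 0) := by
          rw [map_div₀]; field_simp; linear_combination -h
        rw [this]
        exact isAlgebraic_algebraMap _
      · apply le_antisymm
        · rw [IntermediateField.adjoin_simple_le_iff]
          exact sub_mem (IntermediateField.algebraMap_mem _ _) (mul_mem (IntermediateField.algebraMap_mem _ _)
            (IntermediateField.mem_adjoin_simple_self K t))
        · rw [IntermediateField.adjoin_simple_le_iff]
          have h2 := div_mem (sub_mem (IntermediateField.algebraMap_mem _ (v 1)) (IntermediateField.mem_adjoin_simple_self K
            (algebraMap K L (v 1) - algebraMap K L (v 0) * t))) (IntermediateField.algebraMap_mem _ (v 0))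
          convert h2 using 1
          field_simp
          ring
      · intro q hq
        refine ⟨hev q hq, ?_⟩
        obtain ⟨e1, e2⟩ := hS q hq
        refine ⟨C (v 0) * pderiv 0 f + C (v 1) * pderiv 1 f, pderiv 1 f, fun h => hsm q e1 ⟨?_, h⟩, ?_, by simpa using e2⟩
        · rw [h, mul_zero, add_zero] at e2
          exact (mul_eq_zero.1 e2).resolve_left h0
        · change (algebraMap K L (v 1) - algebraMap K L (v 0) * t) * aeval x (pderiv 1 f) =
            aeval x (C (v 0) * pderiv 0 f + C (v 1) * pderiv 1 f)
          simp only [map_mul, map_add, aeval_C, ← hfx, ← hfy]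
          linear_combination -algebraMap K L (v 0) * htd
  · intro a ha
    obtain ⟨S, hS, hS'⟩ := hH' a ha
    refine ⟨S, hS, fun q hq => ⟨?_, hS' q hq _ _ htd⟩⟩
    have := hS' q hq f 0 (by rw [(hker f).2 dvd_rfl]; simp)
    simpa using this

theorem aux_tangent {K : Type} [Field K] (W : Set (Fin 2 → K)) (f : MvPolynomial (Fin 2) K)
    (hW : vanishingIdeal K W = Ideal.span {f}) (q : Fin 2 → K) (hq : eval q f = 0)
    (y : Fin 2 → K) : y ∈ tangentSpaceAt W q ↔
      y 0 * eval q (pderiv 0 f) + y 1 * eval q (pderiv 1 f) = 0 := by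
  unfold tangentSpaceAt
  simp only [Set.mem_setOf_eq, hW, Fin.sum_univ_two]
  constructor
  · intro h
    have := h f (Ideal.mem_span_singleton_self f)
    linear_combination this
  · intro h g hg
    obtain ⟨c, rfl⟩ := Ideal.mem_span_singleton.1 hg
    simp only [Derivation.leibniz, smul_eq_mul, map_add, map_mul, hq]
    linear_combination (eval q c) * h

theorem aux_fiber {K : Type} [Field K] {n : ℕ} (W : Set (Fin n → K)) (v : Fin n → K) :
    {z ∈ tangentBundle W | sndProj z = v}.ncard = {q ∈ W | v ∈ tangentSpaceAt W q}.ncard := by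
  refine Set.ncard_congr (fun z _ => fstProj z) ?_ ?_ ?_
  · rintro z ⟨⟨h1, h2⟩, rfl⟩
    exact ⟨h1, h2⟩
  · rintro z z' ⟨_, h⟩ ⟨_, h'⟩ e
    funext i
    refine Fin.addCases (fun i => congrFun e i) (fun i => congrFun (h.trans h'.symm) i) i
  · rintro q ⟨h1, h2⟩
    have e1 : fstProj (Fin.append q v) = q := by funext i; simp [fstProj]
    have e2 : sndProj (Fin.append q v) = v := by funext i; exact Fin.append_right q v i
    refine ⟨Fin.append q v, ⟨⟨?_, ?_⟩, e2⟩, e1⟩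
    · rw [e1]; exact h1
    · rw [e1, e2]; exact h2

theorem aux_krull {K : Type} [Field K] (W : Set (Fin 2 → K)) (h : varDim W = 1) :
    ringKrullDim (MvPolynomial (Fin 2) K ⧸ vanishingIdeal K W) = 1 := by
  unfold varDim at h
  generalize ringKrullDim (MvPolynomial (Fin 2) K ⧸ vanishingIdeal K W) = k at h
  induction k using WithBot.recBotCoe with
  | bot => simp at h
  | coe k =>
    rw [WithBot.unbotD_coe] at h
    induction k using ENat.recTopCoe with
    | top => simp at h
    | coe k => simp at h; subst h; rfl

theorem aux_parallel {K : Type} [Field K] (a b : K) (v y : Fin 2 → K) (hv : v ≠ 0)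
    (hab : ¬ (a = 0 ∧ b = 0))
    (h : v 0 * a + v 1 * b = 0) : y 0 * a + y 1 * b = 0 ↔ y 0 * v 1 = y 1 * v 0 := by
  constructor
  · intro h'
    by_contra hne
    apply hab
    have hne' := sub_ne_zero.2 hne
    constructor
    · refine (mul_eq_zero.1 (?_ : (y 0 * v 1 - y 1 * v 0) * a = 0)).resolve_left hne'
      linear_combination v 1 * h' - y 1 * h
    · refine (mul_eq_zero.1 (?_ : (y 0 * v 1 - y 1 * v 0) * b = 0)).resolve_left hne'
      linear_combination y 0 * h - v 0 * h'
  · intro h'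
    by_cases h0 : v 0 = 0
    · have h1 : v 1 ≠ 0 := by
        intro h1; apply hv; ext i; fin_cases i <;> simp [h0, h1]
      refine (mul_eq_zero.1 (?_ : v 1 * (y 0 * a + y 1 * b) = 0)).resolve_left h1
      linear_combination a * h' + y 1 * h
    · refine (mul_eq_zero.1 (?_ : v 0 * (y 0 * a + y 1 * b) = 0)).resolve_left h0
      linear_combination y 0 * h - b * h'

theorem aux_main {K : Type} [Field K] [IsAlgClosed K] [CharZero K]
    (W : Set (Fin 2 → K)) (hC : IsSmoothCurve W) (hl : ¬ IsLine W) :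
    omegaCurve W =
      sSup {m | ∃ p ∈ W, {q ∈ W | tangentSpaceAt W q = tangentSpaceAt W p}.ncard = m} := by
  obtain ⟨⟨⟨I, hI⟩, hprime⟩, hdim, hsmooth⟩ := hC
  obtain ⟨f, hf, hfW⟩ := aux_exists_gen (vanishingIdeal K W) (aux_krull W hdim)
  have hWz : W = zeroLocus K (Ideal.span {f}) := by
    rw [← hfW]
    apply Set.Subset.antisymm
    · intro q hq g hg
      exact hg q hq
    · intro q hq
      rw [hI]
      intro g hg
      apply hq
      intro q' hq'
      rw [hI] at hq'
      exact hq' g hg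
  have hmem : ∀ q, q ∈ W ↔ eval q f = 0 := by
    intro q
    rw [hWz]
    constructor
    · intro h
      have := h f (Ideal.mem_span_singleton_self f)
      simpa [aeval_eq_eval] using this
    · intro h g hg
      obtain ⟨c, rfl⟩ := Ideal.mem_span_singleton.1 hg
      simp [aeval_eq_eval, h]
  have hne : W.Nonempty := by
    rw [Set.nonempty_iff_ne_empty]
    rintro rfl
    apply hprime.ne_top
    rw [Ideal.eq_top_iff_one]
    intro q hq
    exact hq.elim
  obtain ⟨p₀, hp₀⟩ := hne
  have hT : ∀ q, eval q f = 0 → ∀ y, y ∈ tangentSpaceAt W q ↔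
      y 0 * eval q (pderiv 0 f) + y 1 * eval q (pderiv 1 f) = 0 :=
    fun q hq y => aux_tangent W f hfW q hq y
  have hsm : ∀ q, eval q f = 0 → ¬ (eval q (pderiv 0 f) = 0 ∧ eval q (pderiv 1 f) = 0) := by
    rintro q hq ⟨h0, h1⟩
    have h2 : tangentSpaceAt W q = Set.univ := by
      rw [Set.eq_univ_iff_forall]
      intro y
      rw [hT q hq, h0, h1]; simp
    have h3 := hsmooth q ((hmem q).2 hq)
    unfold IsSmoothAt tangentDimAt at h3
    rw [h2, hdim, Submodule.span_univ, finrank_top] at h3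
    simp at h3
  have hnd : ∀ v : Fin 2 → K, v ≠ 0 → ¬ f ∣ C (v 0) * pderiv 0 f + C (v 1) * pderiv 1 f :=
    fun v hv hd => hl (aux_line_s13 W f hf hWz p₀ hp₀ v hv hd)
  obtain ⟨d, hd, H, hH, hup, hlow⟩ := aux_core f hf hnd hsm
  have hF : ∀ v : Fin 2 → K, v ≠ 0 → {q ∈ W | v ∈ tangentSpaceAt W q}.Finite ∧
      {q ∈ W | v ∈ tangentSpaceAt W q}.ncard ≤ d := by
    intro v hv
    have hfs : ∀ S : Finset (Fin 2 → K), (S : Set (Fin 2 → K)) ⊆ {q ∈ W | v ∈ tangentSpaceAt W q} →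
        S.card ≤ d := by
      intro S hS
      refine hup v hv S (fun q hq => ?_)
      have h1 := hS hq
      have h2 := (hmem q).1 h1.1
      exact ⟨h2, (hT q h2 v).1 h1.2⟩
    have hfin : {q ∈ W | v ∈ tangentSpaceAt W q}.Finite := by
      by_contra hinf
      obtain ⟨S, hS, hS'⟩ := Set.Infinite.exists_subset_card_eq hinf (d + 1)
      have := hfs S hS
      omega
    refine ⟨hfin, ?_⟩
    rw [Set.ncard_eq_toFinset_card _ hfin]
    exact hfs _ (by simp)
  have hG : ∀ v : Fin 2 → K, v 0 ≠ 0 → H.eval (v 1 / v 0) ≠ 0 →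
      {q ∈ W | v ∈ tangentSpaceAt W q}.ncard = d := by
    intro v h0 h1
    have hv : v ≠ 0 := by rintro rfl; exact h0 rfl
    obtain ⟨S, hS, hS'⟩ := hlow _ h1
    refine le_antisymm (hF v hv).2 ?_
    rw [← hS, ← Set.ncard_coe_finset]
    refine Set.ncard_le_ncard ?_ (hF v hv).1
    intro q hq
    obtain ⟨e1, e2⟩ := hS' q hq
    refine ⟨(hmem q).2 e1, (hT q e1 v).2 ?_⟩
    field_simp at e2
    linear_combination e2
  have hTp : ∀ p ∈ W, ∀ v : Fin 2 → K, v ≠ 0 → v ∈ tangentSpaceAt W p →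
      {q ∈ W | tangentSpaceAt W q = tangentSpaceAt W p} = {q ∈ W | v ∈ tangentSpaceAt W q} := by
    intro p hp v hv hvp
    ext q
    constructor
    · rintro ⟨h1, h2⟩
      exact ⟨h1, by rw [h2]; exact hvp⟩
    · rintro ⟨h1, h2⟩
      refine ⟨h1, ?_⟩
      have hp' := (hmem p).1 hp
      have hq' := (hmem q).1 h1
      ext y
      rw [hT q hq', hT p hp',
        aux_parallel _ _ v y hv (hsm q hq') ((hT q hq' v).1 h2),
        aux_parallel _ _ v y hv (hsm p hp') ((hT p hp' v).1 hvp)]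
  classical
  let ζ : MvPolynomial (Fin 2) K := X 0 * ∏ ρ ∈ H.roots.toFinset, (X 1 - C ρ * X 0)
  have hζ0 : ζ ≠ 0 := by
    refine mul_ne_zero (X_ne_zero _) (Finset.prod_ne_zero_iff.2 ?_)
    intro ρ _ h
    have := congrArg (eval ![0, 1]) h
    simp at this
  have hζ : ∀ v : Fin 2 → K, eval v ζ ≠ 0 → v 0 ≠ 0 ∧ H.eval (v 1 / v 0) ≠ 0 := by
    intro v hv
    simp only [ζ, map_mul, eval_X, map_prod, map_sub, eval_C] at hv
    have h0 : v 0 ≠ 0 := left_ne_zero_of_mul hv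
    refine ⟨h0, fun h => ?_⟩
    have h1 := Finset.prod_ne_zero_iff.1 (right_ne_zero_of_mul hv) (v 1 / v 0)
      (by simp [hH, Polynomial.IsRoot, h])
    apply h1
    field_simp
    ring
  have hgen : ∀ v : Fin 2 → K, eval v ζ ≠ 0 → {q ∈ W | v ∈ tangentSpaceAt W q}.ncard = d :=
    fun v hv => hG v (hζ v hv).1 (hζ v hv).2
  have hpt : ∀ g : MvPolynomial (Fin 2) K, g ≠ 0 → ∃ v, eval v g ≠ 0 := by
    intro g hg
    by_contra! h
    exact hg (MvPolynomial.funext (by simpa using h))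
  have hnef : ∀ v : Fin 2 → K, eval v ζ ≠ 0 → ∃ q ∈ W, v ∈ tangentSpaceAt W q := by
    intro v hv
    have := hgen v hv
    have h1 : {q ∈ W | v ∈ tangentSpaceAt W q}.Nonempty := by
      apply Set.nonempty_of_ncard_ne_zero
      omega
    obtain ⟨q, h⟩ := h1
    exact ⟨q, h.1, h.2⟩
  have htan : tangentialVariety W = Set.univ := by
    rw [Set.eq_univ_iff_forall]
    intro y g hg
    suffices h : g = 0 by rw [h]; simp
    by_contra hg0
    obtain ⟨v, hv⟩ := hpt (g * ζ) (mul_ne_zero hg0 hζ0)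
    rw [map_mul] at hv
    obtain ⟨q, hq, hvq⟩ := hnef v (right_ne_zero_of_mul hv)
    apply left_ne_zero_of_mul hv
    have e1 : fstProj (Fin.append q v) = q := by funext i; simp [fstProj]
    have e2 : sndProj (Fin.append q v) = v := by funext i; exact Fin.append_right q v i
    have := hg v ⟨Fin.append q v, ⟨by rw [e1]; exact hq, by rw [e1, e2]; exact hvq⟩, e2⟩
    simpa [aeval_eq_eval] using this
  have hom : omegaCurve W = d := by
    unfold omegaCurve
    rw [if_neg hl, htan]
    have hset : {m | ∃ Z : Set (Fin 2 → K), IsAlgebraicSet Z ∧ ¬ Set.univ ⊆ Z ∧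
        ∀ v ∈ Set.univ \ Z, {z ∈ tangentBundle W | sndProj z = v}.ncard = m} = {d} := by
      ext m
      rw [Set.mem_singleton_iff]
      constructor
      · rintro ⟨Z, ⟨J, rfl⟩, hZ, hm⟩
        obtain ⟨w, hw⟩ : ∃ w, w ∉ zeroLocus K J := by
          by_contra! h
          exact hZ (fun w _ => h w)
        have hw' : ∃ g ∈ J, eval w g ≠ 0 := by
          by_contra! h
          exact hw (fun g hg => by simpa [aeval_eq_eval] using h g hg)
        obtain ⟨g, hgJ, hg⟩ := hw'
        have hg0 : g ≠ 0 := by rintro rfl; simp at hg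
        obtain ⟨v, hv⟩ := hpt (g * ζ) (mul_ne_zero hg0 hζ0)
        rw [map_mul] at hv
        rw [← hm v ⟨trivial, fun h => left_ne_zero_of_mul hv
          (by simpa [aeval_eq_eval] using h g hgJ)⟩, aux_fiber]
        exact hgen v (right_ne_zero_of_mul hv)
      · rintro rfl
        refine ⟨zeroLocus K (Ideal.span {ζ}), ⟨_, rfl⟩, ?_, ?_⟩
        · intro h
          obtain ⟨v, hv⟩ := hpt ζ hζ0
          have := h (Set.mem_univ v) ζ (Ideal.mem_span_singleton_self ζ)
          exact hv (by simpa [aeval_eq_eval] using this)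
        · rintro v ⟨_, hv⟩
          rw [aux_fiber]
          apply hgen
          intro h
          apply hv
          intro g hg
          obtain ⟨c, rfl⟩ := Ideal.mem_span_singleton.1 hg
          simp [aeval_eq_eval, h]
    rw [hset, csInf_singleton]
  rw [hom]
  symm
  apply IsGreatest.csSup_eq
  constructor
  · obtain ⟨v, hv⟩ := hpt ζ hζ0
    obtain ⟨p, hp, hvp⟩ := hnef v hv
    refine ⟨p, hp, ?_⟩
    have hv0 : v ≠ 0 := by rintro rfl; exact (hζ 0 hv).1 rfl
    rw [hTp p hp v hv0 hvp]
    exact hgen v hv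
  · rintro m ⟨p, hp, rfl⟩
    have hp' := (hmem p).1 hp
    let v : Fin 2 → K := ![- eval p (pderiv 1 f), eval p (pderiv 0 f)]
    have hv0 : v ≠ 0 := by
      intro h
      apply hsm p hp'
      have h0 := congrFun h 0
      have h1 := congrFun h 1
      simp [v] at h0 h1
      exact ⟨h1, h0⟩
    have hvp : v ∈ tangentSpaceAt W p := by
      rw [hT p hp']
      simp [v]; ring
    rw [hTp p hp v hv0 hvp]
    exact (hF v hv0).2

/-- For a smooth irreducible plane curve `C ⊆ A²` which is not a line, `ω(C)` is the
maximal number of points of `C` sharing the tangent space of some point of `C`. -/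
theorem omegaCurve_plane_curve {K : Type} [Field K] [IsAlgClosed K] [CharZero K]
    (C : Set (Fin 2 → K)) (hC : IsSmoothCurve C) (hl : ¬ IsLine C) :
    omegaCurve C =
      sSup {m | ∃ p ∈ C, {q ∈ C | tangentSpaceAt C q = tangentSpaceAt C p}.ncard = m} := by
  exact aux_main C hC hl
end

section
/- Let X ⊆ A^{n+m} be an algebraic variety defined by polynomials in K[x₁,…,x_n, y₁,…,y_m] such that for every (x,y) ∈ X and every λ ∈ K, the point (x, λy) lies in X. Let X̄ ⊆ P^{n+m} be the projective closure of X (with homogenizing variable x₀). Then the homogeneous ideal I(X̄) ⊆ K[x₀,x₁,…,x_n, y₁,…,y_m] is bihomogeneous, i.e., it is generated by polynomials that are homogeneous both in (x₀,x₁,…,x_n) and in (y₁,…,y_m). -/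
open MvPolynomial

theorem vanish_comp_aux {K σ : Type} [Field K] [CharZero K] (w : σ → ℕ) (C : Set (σ → K))
    (hC : ∀ c ∈ C, ∀ a : K, a ≠ 0 → (fun s => a ^ w s * c s) ∈ C)
    (f : MvPolynomial σ K) (hf : f ∈ vanishingIdeal K C) (d : ℕ) :
    weightedHomogeneousComponent w d f ∈ vanishingIdeal K C := by
  classical
  rw [mem_vanishingIdeal_iff] at hf ⊢
  intro c hc
  -- evaluate `f` on the scaled point as a polynomial in the scaling parameter
  let P : Polynomial K := aeval (fun s => Polynomial.C (c s) * Polynomial.X ^ w s) f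
  have hcoeff : ∀ g : MvPolynomial σ K,
      (aeval (fun s => Polynomial.C (c s) * Polynomial.X ^ w s) g : Polynomial K).coeff d =
        aeval c (weightedHomogeneousComponent w d g) := by
    intro g
    induction g using MvPolynomial.induction_on' with
    | monomial u r =>
      have h1 : (aeval (fun s => Polynomial.C (c s) * Polynomial.X ^ w s) (monomial u r) :
          Polynomial K) = Polynomial.C (aeval c (monomial u r)) *
            Polynomial.X ^ (Finsupp.weight w u) := by
        simp only [aeval_monomial, mul_pow, Finsupp.prod_mul, Finsupp.weight_apply]
        simp [Finsupp.prod, Finsupp.sum, ← pow_mul, Finset.prod_pow_eq_pow_sum, mul_comm]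
        ring
      rw [h1, Polynomial.coeff_C_mul, Polynomial.coeff_X_pow]
      by_cases h : d = Finsupp.weight w u
      · rw [weightedHomogeneousComponent_of_mem
          (isWeightedHomogeneous_monomial w u r rfl)]
        simp [h]
      · rw [weightedHomogeneousComponent_of_mem
          (isWeightedHomogeneous_monomial w u r rfl)]
        simp [h, Ne.symm h]
    | add p q hp hq => simp [hp, hq]
  have hP : P = 0 := by
    apply Polynomial.eq_zero_of_infinite_isRoot
    apply Set.Infinite.mono (s := {a : K | a ≠ 0})
    · intro a ha
      have := hf _ (hC c hc a ha)
      rw [Set.mem_ofPred_eq, Polynomial.IsRoot.def]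
      rw [← this, ← Polynomial.coe_aeval_eq_eval]
      change ((Polynomial.aeval a).comp (aeval _)) f = _
      congr 1
      ext s
      rw [AlgHom.comp_apply, aeval_X, aeval_X, map_mul, map_pow, Polynomial.aeval_X,
        Polynomial.aeval_C, mul_comm]
      rfl
    · exact (Set.finite_singleton (0 : K)).infinite_compl
  have := hcoeff f
  change P.coeff d = _ at this
  rw [← this, hP]; simp

theorem comp_homog_aux {K σ : Type} [Field K] (w v : σ → ℕ) (f : MvPolynomial σ K) (d e : ℕ)
    (hf : IsWeightedHomogeneous w f e) :
    IsWeightedHomogeneous w (weightedHomogeneousComponent v d f) e := by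
  classical
  intro u hu
  rw [coeff_weightedHomogeneousComponent] at hu
  apply hf
  intro h
  simp [h] at hu

/-- If `X ⊆ A^{n+m}` is an algebraic set stable under scaling of the last `m`
coordinates, then the homogeneous vanishing ideal of its projective closure (here
formalized as the vanishing ideal of the affine cone `{t·(1, x, y) : (x, y) ∈ X}`
over `X` in `A^{1+n+m}`) is generated by polynomials that are homogeneous in the
variables `(x₀, x₁, …, x_n)` and in the variables `(y₁, …, y_m)` separately. -/
theorem bihomogeneous_vanishingIdeal_projective_closure {K : Type} [Field K]
    [IsAlgClosed K] [CharZero K] {n m : ℕ} (X : Set ((Fin n ⊕ Fin m) → K))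
    (I : Ideal (MvPolynomial (Fin n ⊕ Fin m) K)) (hX : X = zeroLocus K I)
    (hscale : ∀ z ∈ X, ∀ lam : K,
      (Sum.elim (fun i => z (Sum.inl i)) fun j => lam * z (Sum.inr j)) ∈ X) :
    ∃ S : Set (MvPolynomial (Unit ⊕ (Fin n ⊕ Fin m)) K),
      vanishingIdeal K
          {w : (Unit ⊕ (Fin n ⊕ Fin m)) → K |
            ∃ t : K, ∃ z ∈ X, w = fun s => t * Sum.elim (fun _ => 1) z s} =
        Ideal.span S ∧
      ∀ f ∈ S,
        (∃ d₁ : ℕ, IsWeightedHomogeneous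
          (Sum.elim (fun _ => 1) (Sum.elim (fun _ => 1) fun _ => 0)) f d₁) ∧
        (∃ d₂ : ℕ, IsWeightedHomogeneous
          (Sum.elim (fun _ => 0) (Sum.elim (fun _ => 0) fun _ => 1)) f d₂) := by
  classical
  set C := {w : (Unit ⊕ (Fin n ⊕ Fin m)) → K |
            ∃ t : K, ∃ z ∈ X, w = fun s => t * Sum.elim (fun _ => 1) z s} with hCdef
  set w₁ : Unit ⊕ (Fin n ⊕ Fin m) → ℕ :=
    Sum.elim (fun _ => 1) (Sum.elim (fun _ => 1) fun _ => 0) with hw₁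
  set w₂ : Unit ⊕ (Fin n ⊕ Fin m) → ℕ :=
    Sum.elim (fun _ => 0) (Sum.elim (fun _ => 0) fun _ => 1) with hw₂
  have h₁ : ∀ c ∈ C, ∀ a : K, a ≠ 0 → (fun s => a ^ w₁ s * c s) ∈ C := by
    rintro c ⟨t, z, hz, rfl⟩ a ha
    refine ⟨a * t, _, hscale z hz a⁻¹, ?_⟩
    funext s
    rcases s with s | s | s
    · simp [hw₁]
    · simp [hw₁, mul_assoc]
    · simp [hw₁]; field_simp
  have h₂ : ∀ c ∈ C, ∀ a : K, a ≠ 0 → (fun s => a ^ w₂ s * c s) ∈ C := by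
    rintro c ⟨t, z, hz, rfl⟩ a ha
    refine ⟨t, _, hscale z hz a, ?_⟩
    funext s
    rcases s with s | s | s
    · simp [hw₂]
    · simp [hw₂]
    · simp [hw₂]; ring
  refine ⟨{f | f ∈ vanishingIdeal K C ∧ (∃ d₁ : ℕ, IsWeightedHomogeneous w₁ f d₁) ∧
    (∃ d₂ : ℕ, IsWeightedHomogeneous w₂ f d₂)}, le_antisymm ?_ ?_, fun f hf => hf.2⟩
  · intro f hf
    rw [← sum_weightedHomogeneousComponent w₁ f,
      finsum_eq_sum _ (weightedHomogeneousComponent_finsupp f)]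
    refine Ideal.sum_mem _ fun d _ => ?_
    rw [← sum_weightedHomogeneousComponent w₂ (weightedHomogeneousComponent w₁ d f),
      finsum_eq_sum _ (weightedHomogeneousComponent_finsupp _)]
    refine Ideal.sum_mem _ fun e _ => Ideal.subset_span ⟨?_, ⟨d, ?_⟩, ⟨e, ?_⟩⟩
    · exact vanish_comp_aux w₂ C h₂ _ (vanish_comp_aux w₁ C h₁ f hf d) e
    · exact comp_homog_aux w₁ w₂ _ e d (weightedHomogeneousComponent_isWeightedHomogeneous d f)
    · exact weightedHomogeneousComponent_isWeightedHomogeneous e _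
  · exact Ideal.span_le.2 fun f hf => hf.1
end
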